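/- Fix an integer k ≥ 0. There exist constants c_1 > 0, c_2 > 0, and C > 0 depending only on k such that the following holds: for all integers N ≥ 1 and d ≥ 1 and all real polynomials Q_1,…,Q_d of degree at most k, there exist L disjoint arithmetic progressions P_1,…,P_L whose union is [N] such that (i) N/L ≥ N^{c_1/d^{c_2}}/2, and (ii) for every 1 ≤ i ≤ d and 1 ≤ j ≤ L and all n, n' ∈ P_j, ‖Q_i(n) − Q_i(n')‖_{ℝ/ℤ} ≤ C · N^{−c_1/d^{c_2}}. -/

import Mathlib

section

open Finset
open scoped Polynomial ComplexConjugate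

/-- The distance from a real number to the nearest integer. -/
noncomputable def distInt (x : ℝ) : ℝ := |x - round x|

lemma distInt_le_abs_sub (x : ℝ) (z : ℤ) : distInt x ≤ |x - z| := round_le x z

lemma distInt_nonneg (x : ℝ) : 0 ≤ distInt x := abs_nonneg _

lemma distInt_le_half (x : ℝ) : distInt x ≤ 1 / 2 := abs_sub_round x

lemma distInt_add_le (x y : ℝ) : distInt (x + y) ≤ distInt x + distInt y := by
  refine (distInt_le_abs_sub (x + y) (round x + round y)).trans ?_
  push_cast
  rw [add_sub_add_comm]
  exact abs_add_le _ _

lemma distInt_neg (x : ℝ) : distInt (-x) = distInt x := by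
  have key : ∀ y : ℝ, distInt (-y) ≤ distInt y := fun y => by
    refine (distInt_le_abs_sub (-y) (-round y)).trans_eq ?_
    rw [distInt, ← abs_neg]
    push_cast
    congr 1
    ring
  exact le_antisymm (key x) (by simpa using key (-x))

lemma distInt_sub_le (x y : ℝ) : distInt (x - y) ≤ distInt x + distInt y := by
  simpa [sub_eq_add_neg, distInt_neg] using distInt_add_le x (-y)

lemma distInt_int_mul_le (n : ℤ) (x : ℝ) : distInt (n * x) ≤ |(n : ℝ)| * distInt x := by
  refine (distInt_le_abs_sub (n * x) (n * round x)).trans_eq ?_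
  rw [distInt, ← abs_mul]
  push_cast
  congr 1
  ring

lemma distInt_nat_mul_le (n : ℕ) (x : ℝ) : distInt (n * x) ≤ n * distInt x := by
  simpa using distInt_int_mul_le n x

lemma distInt_sum_le {ι : Type*} (s : Finset ι) (f : ι → ℝ) :
    distInt (∑ i ∈ s, f i) ≤ ∑ i ∈ s, distInt (f i) :=
  le_sum_of_subadditive distInt (by simp [distInt]) distInt_add_le s f

lemma Int.card_le_of_abs_sub_le {s : Finset ℤ} {D : ℝ} (hD : 0 ≤ D)
    (h : ∀ a ∈ s, ∀ b ∈ s, |(a : ℝ) - b| ≤ D) : (#s : ℝ) ≤ D + 1 := by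
  rcases s.eq_empty_or_nonempty with rfl | hs
  · simp; linarith
  have hsub : s ⊆ Icc (s.min' hs) (s.min' hs + ⌊D⌋) := by
    intro a ha
    rw [mem_Icc]
    refine ⟨s.min'_le a ha, ?_⟩
    have h1 := (le_abs_self _).trans (h a ha _ (s.min'_mem hs))
    have h2 : a - s.min' hs ≤ ⌊D⌋ := Int.le_floor.2 (by push_cast; exact h1)
    linarith
  have h1 := card_le_card hsub
  rw [Int.card_Icc] at h1
  have h3 : (0 : ℤ) ≤ ⌊D⌋ := Int.floor_nonneg.2 hD
  have h2 : ((#s : ℕ) : ℤ) ≤ ⌊D⌋ + 1 := by omega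
  have h4 : ((#s : ℕ) : ℝ) ≤ (⌊D⌋ : ℝ) + 1 := by exact_mod_cast h2
  linarith [Int.floor_le D]

/-- Few terms of a slowly varying arithmetic progression are close to integers. -/
lemma card_mul_le_of_distInt_le {J : Finset ℤ} {X τ ε c : ℝ} (hτ : τ ≠ 0) (hε : 0 ≤ ε)
    (hε' : ε ≤ 1 / 2) (hX : 0 ≤ X) (hJ : ∀ a ∈ J, ∀ b ∈ J, |(a : ℝ) - b| ≤ X)
    (h : ∀ j ∈ J, distInt (c + j * τ) ≤ ε) :
    (#J : ℝ) ≤ (2 * ε / |τ| + 1) * (|τ| * X + 2) := by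
  have hτ' : 0 < |τ| := abs_pos.2 hτ
  set f : ℤ → ℤ := fun j => round (c + j * τ)
  have hf : ∀ j ∈ J, |c + j * τ - f j| ≤ ε := h
  have h1 : (#(J.image f) : ℝ) ≤ |τ| * X + 1 + 1 := by
    refine Int.card_le_of_abs_sub_le (by positivity) ?_
    simp only [mem_image]
    rintro _ ⟨a, ha, rfl⟩ _ ⟨b, hb, rfl⟩
    have e : (f a : ℝ) - f b = (c + b * τ - f b) - (c + a * τ - f a) + (a - b) * τ := by ring
    rw [e]
    refine (abs_add_le _ _).trans ?_
    have := (abs_sub (c + b * τ - f b) (c + a * τ - f a)).trans (add_le_add (hf b hb) (hf a ha))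
    rw [abs_mul]
    nlinarith [hJ a ha b hb]
  have h2 : #J ≤ ⌊2 * ε / |τ| + 1⌋₊ * #(J.image f) := by
    refine card_le_mul_card_image J _ ?_
    intro z hz
    refine Nat.le_floor (Int.card_le_of_abs_sub_le (by positivity) ?_)
    simp only [mem_filter]
    rintro a ⟨ha, haz⟩ b ⟨hb, hbz⟩
    rw [le_div_iff₀ hτ', ← abs_mul]
    have e : ((a : ℝ) - b) * τ = (c + a * τ - f a) - (c + b * τ - f b) := by rw [haz, hbz]; ring
    rw [e]
    linarith [(abs_sub (c + a * τ - f a) (c + b * τ - f b)).trans (add_le_add (hf a ha) (hf b hb))]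
  have h3 : (#J : ℝ) ≤ (⌊2 * ε / |τ| + 1⌋₊ : ℝ) * #(J.image f) := by exact_mod_cast h2
  have h4 : (⌊2 * ε / |τ| + 1⌋₊ : ℝ) ≤ 2 * ε / |τ| + 1 := Nat.floor_le (by positivity)
  refine h3.trans (mul_le_mul h4 (by linarith) (by positivity) (by positivity))

/-- If many multiples `h * β` are very close to integers, then `β` is very close to a rational
with small denominator. -/
lemma exists_distInt_mul_le_of_many {A : Finset ℕ} {M U : ℕ} {β ε : ℝ} (hU : 1 ≤ U)
    (hM : 16 * U ^ 2 ≤ M) (hε : 0 ≤ ε) (hεU : 16 * ε * U ≤ 1) (hA : ∀ h ∈ A, h ≤ M)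
    (hcard : M ≤ U * #A) (h : ∀ h ∈ A, distInt (h * β) ≤ ε) :
    ∃ q : ℕ, 1 ≤ q ∧ q ≤ 2 * U ∧ distInt (q * β) ≤ 16 * ε * U ^ 2 / M := by
  have hMU : 16 * U ≤ M := by nlinarith
  have hMpos : (0 : ℝ) < M := by exact_mod_cast (by omega : 0 < M)
  have hUpos : (1 : ℝ) ≤ U := by exact_mod_cast hU
  obtain ⟨a, ha, b, hb, hab, hq⟩ : ∃ a ∈ A, ∃ b ∈ A, a < b ∧ b - a ≤ 2 * U := by
    have hlt : #(range (M / (2 * U) + 1)) < #A := by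
      rw [card_range]
      have h1 : M / (2 * U) * (2 * U) ≤ M := Nat.div_mul_le_self _ _
      by_contra! hcon
      have h2 : U * #A ≤ U * (M / (2 * U) + 1) := Nat.mul_le_mul_left _ hcon
      nlinarith
    obtain ⟨a, ha, b, hb, hne, he⟩ := exists_ne_map_eq_of_card_lt_of_maps_to hlt
      (f := fun h => h / (2 * U)) (fun x hx => by
        have hx' := hA x hx
        simp only [coe_range, Set.mem_Iio]
        exact Nat.lt_succ_of_le (Nat.div_le_div_right hx'))
    have key : ∀ x y : ℕ, x / (2 * U) = y / (2 * U) → y - x ≤ 2 * U := by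
      intro x y hxy
      have h1 := Nat.div_add_mod x (2 * U)
      have h2 := Nat.div_add_mod y (2 * U)
      have h3 := Nat.mod_lt y (show 2 * U > 0 by omega)
      rw [hxy] at h1
      omega
    rcases lt_or_gt_of_ne hne with hl | hl
    · exact ⟨a, ha, b, hb, hl, key a b he⟩
    · exact ⟨b, hb, a, ha, hl, key b a he.symm⟩
  obtain ⟨q, rfl⟩ : ∃ q, b = a + q := ⟨b - a, by omega⟩
  have hq1 : 1 ≤ q := by omega
  have hq2 : q ≤ 2 * U := by omega
  refine ⟨q, hq1, hq2, ?_⟩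
  have hqpos : (0 : ℝ) < q := by exact_mod_cast hq1
  have hq2' : (q : ℝ) ≤ 2 * U := by exact_mod_cast hq2
  have hqβ : distInt (q * β) ≤ 2 * ε := by
    have e : (q : ℝ) * β = ((a + q : ℕ) : ℝ) * β - a * β := by push_cast; ring
    rw [e]
    linarith [distInt_sub_le (((a + q : ℕ) : ℝ) * β) (a * β), h a ha, h _ hb]
  obtain ⟨r, hr⟩ : ∃ r, #A ≤ q * #{x ∈ A | x % q = r} := by
    by_contra! hcon
    have h1 := card_eq_sum_card_fiberwise (s := A) (t := range q) (f := fun x => x % q)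
      (fun x _ => by simpa using Nat.mod_lt x hq1)
    have h2 : ∑ r ∈ range q, q * #{x ∈ A | x % q = r} < ∑ r ∈ range q, #A :=
      sum_lt_sum_of_nonempty ⟨0, mem_range.2 hq1⟩ (fun i _ => hcon i)
    rw [← mul_sum, ← h1, sum_const, card_range, smul_eq_mul] at h2
    exact lt_irrefl _ h2
  set J : Finset ℤ := ({x ∈ A | x % q = r}).image (fun x => ((x / q : ℕ) : ℤ)) with hJdef
  have hJcard : #J = #{x ∈ A | x % q = r} := by
    refine card_image_of_injOn ?_
    intro x hx y hy hxy
    rw [mem_coe, mem_filter] at hx hy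
    have hxy' : x / q = y / q := Int.natCast_inj.1 hxy
    rw [← Nat.div_add_mod x q, ← Nat.div_add_mod y q, hxy', hx.2, hy.2]
  set τ : ℝ := q * β - round (q * β)
  by_cases hτ : τ = 0
  · have : distInt (q * β) = 0 := by
      change |τ| = 0
      rw [hτ, abs_zero]
    rw [this]
    positivity
  have hτ' : 0 < |τ| := abs_pos.2 hτ
  have hτε : |τ| ≤ 2 * ε := hqβ
  have hmain := card_mul_le_of_distInt_le (J := J) (X := M / q) (τ := τ) (ε := ε) (c := r * β)
    hτ hε (by nlinarith) (by positivity) (by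
      simp only [hJdef, mem_image, mem_filter]
      have key : ∀ x ∈ A, ((x / q : ℕ) : ℝ) ≤ M / q := fun x hx =>
        Nat.cast_div_le.trans (by gcongr; exact hA x hx)
      rintro _ ⟨x, ⟨hx, -⟩, rfl⟩ _ ⟨y, ⟨hy, -⟩, rfl⟩
      have h1 := key x hx
      have h2 := key y hy
      have h3 : (0 : ℝ) ≤ ((x / q : ℕ) : ℝ) := by positivity
      have h4 : (0 : ℝ) ≤ ((y / q : ℕ) : ℝ) := by positivity
      rw [Int.cast_natCast, Int.cast_natCast, abs_le]
      constructor <;> linarith) (by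
      simp only [hJdef, mem_image, mem_filter]
      rintro _ ⟨x, ⟨hx, hxr⟩, rfl⟩
      have e0 := Nat.div_add_mod x q
      rw [hxr] at e0
      generalize x / q = y at e0 ⊢
      have e2 : (r : ℝ) * β + ((y : ℤ) : ℝ) * τ = x * β - ((y : ℤ) * round (q * β) : ℤ) := by
        rw [← e0]
        simp only [τ]
        push_cast
        ring
      rw [e2]
      refine le_trans ?_ (h x hx)
      refine (distInt_le_abs_sub _
        (round ((x : ℝ) * β) - (y : ℤ) * round (q * β))).trans_eq ?_
      rw [distInt]
      congr 1
      push_cast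
      ring)
  have hlow : (M : ℝ) ≤ U * (q * #J) := by
    rw [hJcard]
    exact_mod_cast hcard.trans (Nat.mul_le_mul_left _ hr)
  have hM' : (16 : ℝ) * U ^ 2 ≤ M := by exact_mod_cast hM
  have e : (2 * ε / |τ| + 1) * (|τ| * (M / q) + 2)
      = (2 * ε * M + |τ| * M) / q + 4 * ε / |τ| + 2 := by
    field_simp
    ring
  rw [e] at hmain
  change |τ| ≤ _
  have h5 : (U : ℝ) * (q * #J) ≤ U * (2 * ε * M + |τ| * M) + U * q * (4 * ε / |τ|) + 2 * U * q := by
    have := mul_le_mul_of_nonneg_left hmain (show (0 : ℝ) ≤ U * q by positivity)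
    refine (le_of_eq (by ring)).trans (this.trans_eq ?_)
    field_simp
  have h6 : (M : ℝ) ≤ 2 * (U * q * (4 * ε / |τ|)) := by
    have h7 : (U : ℝ) * (2 * ε * M + |τ| * M) ≤ M / 4 := by
      have : (U : ℝ) * (2 * ε * M + |τ| * M) ≤ U * (2 * ε * M + 2 * ε * M) := by gcongr
      nlinarith
    have h8 : 2 * (U : ℝ) * q ≤ M / 4 := by nlinarith
    linarith
  have h9 : (M : ℝ) * |τ| ≤ 8 * ε * U * q := by
    calc (M : ℝ) * |τ| ≤ 2 * (U * q * (4 * ε / |τ|)) * |τ| := by gcongr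
      _ = _ := by field_simp; ring
  rw [le_div_iff₀ hMpos]
  calc |τ| * M ≤ 8 * ε * U * q := by linarith
    _ ≤ 8 * ε * U * (2 * U) := by gcongr
    _ = _ := by ring

/-- The additive character `x ↦ exp (2πix)`. -/
noncomputable def unitExp (x : ℝ) : ℂ := Complex.exp (Complex.I * ((2 * Real.pi * x : ℝ) : ℂ))

lemma norm_unitExp (x : ℝ) : ‖unitExp x‖ = 1 := Complex.norm_exp_I_mul_ofReal _

lemma unitExp_add (x y : ℝ) : unitExp (x + y) = unitExp x * unitExp y := by
  rw [unitExp, unitExp, unitExp, ← Complex.exp_add]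
  push_cast
  ring_nf

lemma unitExp_nat_mul (n : ℕ) (x : ℝ) : unitExp (n * x) = unitExp x ^ n := by
  rw [unitExp, unitExp, ← Complex.exp_nat_mul]
  push_cast
  ring_nf

lemma unitExp_zero : unitExp 0 = 1 := by simp [unitExp]

lemma conj_unitExp (x : ℝ) : conj (unitExp x) = unitExp (-x) := by
  rw [unitExp, unitExp, ← Complex.exp_conj, map_mul, Complex.conj_I, Complex.conj_ofReal]
  push_cast
  ring_nf

lemma re_unitExp (x : ℝ) : (unitExp x).re = Real.cos (2 * Real.pi * x) := by
  rw [unitExp, mul_comm, Complex.exp_ofReal_mul_I_re]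

lemma two_mul_distInt_le_abs_sin (x : ℝ) : 2 * distInt x ≤ |Real.sin (Real.pi * x)| := by
  have h1 : |Real.sin (Real.pi * x)| = |Real.sin (Real.pi * (x - round x))| := by
    rw [mul_sub, mul_comm Real.pi (round x : ℝ), Real.sin_sub_int_mul_pi, abs_mul, abs_zpow]
    simp
  have h2 : |Real.pi * (x - round x)| ≤ Real.pi / 2 := by
    rw [abs_mul, abs_of_pos Real.pi_pos]
    have := abs_sub_round x
    nlinarith [Real.pi_pos]
  rw [h1]
  refine le_trans (le_of_eq ?_) (Real.mul_abs_le_abs_sin h2)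
  rw [abs_mul, abs_of_pos Real.pi_pos, distInt]
  field_simp

lemma four_mul_distInt_le_norm (x : ℝ) : 4 * distInt x ≤ ‖unitExp x - 1‖ := by
  rw [unitExp, Complex.norm_exp_I_mul_ofReal_sub_one, norm_mul, Real.norm_eq_abs, Real.norm_eq_abs]
  have := two_mul_distInt_le_abs_sin x
  rw [show 2 * Real.pi * x / 2 = Real.pi * x by ring]
  norm_num
  linarith

lemma cos_nonneg_of_distInt_le {x : ℝ} (h : distInt x ≤ 1 / 4) :
    0 ≤ Real.cos (2 * Real.pi * x) := by
  have e : Real.cos (2 * Real.pi * x) = Real.cos (2 * Real.pi * (x - round x)) := by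
    rw [← Real.cos_sub_int_mul_two_pi (2 * Real.pi * x) (round x)]
    congr 1
    ring
  rw [e]
  rw [distInt, abs_le] at h
  apply Real.cos_nonneg_of_neg_pi_div_two_le_of_le <;> nlinarith [Real.pi_pos]

lemma cos_sq_le (x : ℝ) : Real.cos (Real.pi * x) ^ 2 ≤ 1 - 4 * distInt x ^ 2 := by
  rw [Real.cos_sq', ← sq_abs (Real.sin _)]
  have := two_mul_distInt_le_abs_sin x
  have := distInt_nonneg x
  nlinarith

/-- Van der Corput's inequality, with all shifts. -/
lemma norm_sum_sq_le_sum_shift {z : ℕ → ℂ} (hz : ∀ n, ‖z n‖ ≤ 1) (M : ℕ) :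
    ‖∑ n ∈ range M, z n‖ ^ 2
      ≤ M + 2 * ∑ h ∈ range M, ‖∑ n ∈ range (M - 1 - h), z (n + (h + 1)) * conj (z n)‖ := by
  have key : ∀ M : ℕ, ‖∑ n ∈ range M, z n‖ ^ 2
      ≤ M + 2 * (∑ h ∈ range M, ∑ n ∈ range (M - 1 - h), z (n + (h + 1)) * conj (z n)).re := by
    intro M
    induction M with
    | zero => simp
    | succ M ih =>
      have e1 : ∑ h ∈ range (M + 1), ∑ n ∈ range (M + 1 - 1 - h), z (n + (h + 1)) * conj (z n)
          = ∑ h ∈ range M, ∑ n ∈ range (M - 1 - h), z (n + (h + 1)) * conj (z n)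
            + z M * conj (∑ n ∈ range M, z n) := by
        rw [sum_range_succ]
        simp only [Nat.add_sub_cancel, Nat.sub_self, range_zero, sum_empty, add_zero]
        rw [map_sum, ← sum_range_reflect (fun n => conj (z n)), mul_sum, ← sum_add_distrib]
        refine sum_congr rfl fun h hh => ?_
        have hh' := mem_range.1 hh
        rw [show M - h = M - 1 - h + 1 by omega, sum_range_succ,
          show M - 1 - h + (h + 1) = M by omega]
      have e2 : ‖∑ n ∈ range M, z n + z M‖ ^ 2 = ‖∑ n ∈ range M, z n‖ ^ 2 + ‖z M‖ ^ 2
          + 2 * ((∑ n ∈ range M, z n) * conj (z M)).re := by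
        simp only [Complex.sq_norm, Complex.normSq_add]
      rw [e1, sum_range_succ, e2, Complex.add_re]
      have e3 : ((∑ n ∈ range M, z n) * conj (z M)).re = (z M * conj (∑ n ∈ range M, z n)).re := by
        rw [← Complex.conj_re, map_mul, Complex.conj_conj, mul_comm]
      have h1 : ‖z M‖ ^ 2 ≤ 1 := pow_le_one₀ (norm_nonneg _) (hz M)
      push_cast
      linarith
  refine (key M).trans ?_
  gcongr
  exact (Complex.re_le_norm _).trans (norm_sum_le _ _)

section Taylor
variable {P : ℝ[X]} {k : ℕ}

lemma coeff_taylor_of_natDegree_le (hP : P.natDegree ≤ k + 1) (r : ℝ) :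
    (Polynomial.taylor r P).coeff k = P.coeff k + (k + 1) * r * P.coeff (k + 1) := by
  have h : (Polynomial.hasseDeriv k P).natDegree < 2 := by
    have := Polynomial.natDegree_hasseDeriv_le P k
    omega
  rw [Polynomial.taylor_coeff, Polynomial.eval_eq_sum_range' h]
  simp [sum_range_succ, Polynomial.hasseDeriv_coeff, add_comm 1 k, Nat.choose_succ_self_right]
  ring

lemma natDegree_taylor_sub_le (hP : P.natDegree ≤ k + 1) (r : ℝ) :
    (Polynomial.taylor r P - P).natDegree ≤ k := by
  rw [Polynomial.natDegree_le_iff_coeff_eq_zero]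
  intro n hn
  have h := coeff_taylor_of_natDegree_le (P := P) (k := n) (by omega) r
  rw [Polynomial.coeff_sub, h, Polynomial.coeff_eq_zero_of_natDegree_lt (n := n + 1) (by omega)]
  ring
end Taylor

lemma Finset.exists_card_le_mul_card_fiber {α β : Type*} [DecidableEq β] {s : Finset α}
    {t : Finset β} {f : α → β} (ht : t.Nonempty) (hf : ∀ x ∈ s, f x ∈ t) :
    ∃ y ∈ t, #s ≤ #t * #{x ∈ s | f x = y} := by
  by_contra! hcon
  have h2 := sum_lt_sum_of_nonempty ht hcon
  rw [← mul_sum, ← card_eq_sum_card_fiberwise hf, sum_const, smul_eq_mul] at h2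
  exact lt_irrefl _ h2

lemma norm_sum_unitExp_linear_mul_le (a b : ℝ) (M : ℕ) :
    ‖∑ n ∈ range M, unitExp (b + n * a)‖ * (2 * distInt a) ≤ 1 := by
  have e : ∑ n ∈ range M, unitExp (b + n * a) = unitExp b * ∑ n ∈ range M, unitExp a ^ n := by
    rw [mul_sum]
    exact sum_congr rfl fun n _ => by rw [unitExp_add, unitExp_nat_mul]
  rw [e, norm_mul, norm_unitExp, one_mul]
  have h1 : ‖∑ n ∈ range M, unitExp a ^ n‖ * ‖unitExp a - 1‖ ≤ 2 := by
    rw [← norm_mul, geom_sum_mul]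
    refine (norm_sub_le _ _).trans ?_
    simp [norm_unitExp]
    norm_num
  have h2 := four_mul_distInt_le_norm a
  nlinarith [norm_nonneg (∑ n ∈ range M, unitExp a ^ n)]

/-- **Weyl's inequality**, in inverse form: if the exponential sum of a polynomial is large, then
its leading coefficient is close to a rational with small denominator. -/
theorem weyl_inverse (k : ℕ) : ∃ K : ℕ, ∀ T : ℕ, 2 ≤ T → ∀ M M' : ℕ, M' ≤ M → 1 ≤ M →
    ∀ P : ℝ[X], P.natDegree ≤ k + 1 →
      (M : ℝ) ≤ T * ‖∑ n ∈ range M', unitExp (P.eval (n : ℝ))‖ →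
      ∃ q : ℕ, 1 ≤ q ∧ q ≤ T ^ K ∧
        distInt (q * P.coeff (k + 1)) ≤ (T : ℝ) ^ K / (M : ℝ) ^ (k + 1) := by
  induction k with
  | zero =>
    refine ⟨1, fun T hT M M' _ hM P hP hS => ⟨1, le_rfl, by simp; omega, ?_⟩⟩
    have hMpos : (0 : ℝ) < M := by exact_mod_cast hM
    have e : ∀ n : ℕ, P.eval (n : ℝ) = P.coeff 0 + n * P.coeff 1 := by
      intro n
      rw [Polynomial.eval_eq_sum_range' (show P.natDegree < 2 by omega)]
      simp [sum_range_succ, mul_comm]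
    simp only [e] at hS
    have h := norm_sum_unitExp_linear_mul_le (P.coeff 1) (P.coeff 0) M'
    have hd := distInt_nonneg (P.coeff 1)
    simp only [zero_add, pow_one, Nat.cast_one, one_mul]
    rw [le_div_iff₀ hMpos]
    have hTpos : (0 : ℝ) < T := by exact_mod_cast (by omega : 0 < T)
    nlinarith [mul_le_mul_of_nonneg_right hS hd, mul_le_mul_of_nonneg_left h hTpos.le]
  | succ k ih =>
    obtain ⟨K₀, hK₀⟩ := ih
    refine ⟨(14 + 15 * K₀) * (k + 2), fun T hT M M' hM' hM P hP hS => ?_⟩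
    set T₁ := 8 * T ^ 2 with hT₁
    set Q := T₁ ^ K₀ with hQ
    have hTpos : 0 < T := by omega
    have hT₁T : T₁ ≤ T ^ 5 := by
      have : 2 ^ 3 ≤ T ^ 3 := Nat.pow_le_pow_left hT 3
      calc T₁ = 2 ^ 3 * T ^ 2 := by rw [hT₁]; norm_num
        _ ≤ T ^ 3 * T ^ 2 := by gcongr
        _ = T ^ 5 := by ring
    have hT₁pos : 1 ≤ T₁ := Nat.mul_pos (by norm_num) (by positivity)
    have hQpos : 1 ≤ Q := Nat.one_le_pow _ _ hT₁pos
    have hQT : Q ≤ T ^ (5 * K₀) := by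
      rw [pow_mul]
      exact Nat.pow_le_pow_left hT₁T _
    have hbig : 16 * T₁ ^ 2 * Q ^ 3 ≤ T ^ (14 + 15 * K₀) := by
      calc 16 * T₁ ^ 2 * Q ^ 3 ≤ T ^ 4 * (T ^ 5) ^ 2 * (T ^ (5 * K₀)) ^ 3 := by
            gcongr
            exact Nat.pow_le_pow_left hT 4
        _ = _ := by ring
    have hMpos : (0 : ℝ) < M := by exact_mod_cast hM
    by_cases hMbig : M ≤ 16 * T₁ ^ 2 * Q ^ 3
    · refine ⟨1, le_rfl, Nat.one_le_pow _ _ hTpos, ?_⟩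
      refine (distInt_le_half _).trans ?_
      rw [le_div_iff₀ (by positivity)]
      have : M ^ (k + 1 + 1) ≤ T ^ ((14 + 15 * K₀) * (k + 2)) := by
        rw [pow_mul]
        exact Nat.pow_le_pow_left (hMbig.trans hbig) _
      have h : (M : ℝ) ^ (k + 1 + 1) ≤ (T : ℝ) ^ ((14 + 15 * K₀) * (k + 2)) := by
        exact_mod_cast this
      have : (0 : ℝ) ≤ (M : ℝ) ^ (k + 1 + 1) := by positivity
      linarith
    push Not at hMbig
    set θ := P.coeff (k + 1 + 1) with hθ
    set D : ℕ → ℝ[X] := fun h => Polynomial.taylor ((h + 1 : ℕ) : ℝ) P - P with hD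
    set a : ℕ → ℝ := fun h => ‖∑ n ∈ range (M' - 1 - h), unitExp ((D h).eval (n : ℝ))‖ with ha
    have haM : ∀ h, a h ≤ M := by
      intro h
      refine (norm_sum_le _ _).trans ?_
      simp only [norm_unitExp, sum_const, card_range, nsmul_eq_mul, mul_one]
      exact_mod_cast (by omega)
    have hvdc := norm_sum_sq_le_sum_shift (z := fun n => unitExp (P.eval (n : ℝ)))
      (fun n => (norm_unitExp _).le) M'
    have hsum : (M : ℝ) ^ 2 / (4 * T ^ 2) ≤ ∑ h ∈ range M', a h := by
      have e : ∀ h ∈ range M', ‖∑ n ∈ range (M' - 1 - h),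
          unitExp (P.eval ((n + (h + 1) : ℕ) : ℝ)) * conj (unitExp (P.eval (n : ℝ)))‖ = a h := by
        intro h _
        simp only [ha, hD]
        congr 1
        refine sum_congr rfl fun n _ => ?_
        rw [conj_unitExp, ← unitExp_add, Polynomial.eval_sub, Polynomial.taylor_eval]
        push_cast
        ring_nf
      rw [sum_congr rfl e] at hvdc
      have hTpos' : (0 : ℝ) < T := by exact_mod_cast hTpos
      have h1 : (M : ℝ) ^ 2 ≤ T ^ 2 * ‖∑ n ∈ range M', unitExp (P.eval (n : ℝ))‖ ^ 2 := by
        rw [← mul_pow]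
        exact pow_le_pow_left₀ hMpos.le hS 2
      have h2 : 2 * T ^ 2 ≤ M := by
        have : 1 ≤ T₁ * Q ^ 3 := Nat.mul_pos hT₁pos (by positivity)
        nlinarith
      have h2' : 2 * (T : ℝ) ^ 2 ≤ M := by exact_mod_cast h2
      have h3 : (M' : ℝ) ≤ M := by exact_mod_cast hM'
      rw [div_le_iff₀ (by positivity)]
      have h4 : (M : ℝ) ^ 2 ≤ T ^ 2 * (M + 2 * ∑ h ∈ range M', a h) :=
        h1.trans (by gcongr; linarith)
      nlinarith
    set H := {h ∈ range M' | (M : ℝ) ≤ T₁ * a h} with hH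
    have hHcard : M ≤ T₁ * #H := by
      have h1 : ∑ h ∈ range M', a h ≤ #H * M + M * (M / T₁) := by
        rw [← sum_filter_add_sum_filter_not (range M') (fun h => (M : ℝ) ≤ T₁ * a h)]
        refine add_le_add ?_ ?_
        · rw [← nsmul_eq_mul]
          exact sum_le_card_nsmul _ _ _ fun h _ => haM h
        · refine (sum_le_card_nsmul _ _ ((M : ℝ) / T₁) fun h hh => ?_).trans ?_
          · rw [mem_filter, not_le] at hh
            rw [le_div_iff₀ (by exact_mod_cast hT₁pos)]
            linarith [hh.2]
          · rw [nsmul_eq_mul]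
            gcongr
            exact (card_filter_le _ _).trans (by simpa using hM')
      have h2 : (M : ℝ) ^ 2 / (4 * T ^ 2) = 2 * (M * (M / T₁)) := by
        rw [hT₁]
        push_cast
        field_simp
        norm_num
      have h3 : (M : ℝ) * (M / T₁) ≤ M * #H := by linarith
      have h4 := le_of_mul_le_mul_left h3 hMpos
      rw [div_le_iff₀ (by exact_mod_cast hT₁pos)] at h4
      rw [mul_comm]
      exact_mod_cast h4
    have hex : ∀ h, ∃ q : ℕ, h ∈ H → 1 ≤ q ∧ q ≤ Q ∧
        distInt (q * ((k + 2) * (h + 1 : ℕ) * θ)) ≤ (Q : ℝ) / (M : ℝ) ^ (k + 1) := by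
      intro h
      by_cases hh : h ∈ H
      · obtain ⟨q, hq1, hq2, hq3⟩ := hK₀ T₁ (by nlinarith) M (M' - 1 - h) (by omega) hM (D h)
          (natDegree_taylor_sub_le hP _) (mem_filter.1 hh).2
        refine ⟨q, fun _ => ⟨hq1, hq2, ?_⟩⟩
        rw [hD] at hq3
        simp only [Polynomial.coeff_sub, coeff_taylor_of_natDegree_le hP] at hq3
        convert hq3 using 2
        · push_cast
          ring
        · rw [hQ]
          push_cast
          rfl
      · exact ⟨0, fun h => absurd h hh⟩
    choose q hq using hex
    obtain ⟨q₀, hq₀, hcard⟩ := exists_card_le_mul_card_fiber (s := H) (t := Icc 1 Q) (f := q)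
      ⟨1, by simpa using hQpos⟩ (fun h hh => mem_Icc.2 ⟨(hq h hh).1, (hq h hh).2.1⟩)
    rw [Nat.card_Icc, Nat.add_sub_cancel] at hcard
    rw [mem_Icc] at hq₀
    obtain ⟨q', hq'1, hq'2, hq'3⟩ := exists_distInt_mul_le_of_many
      (A := ({h ∈ H | q h = q₀}).image (· + 1)) (M := M) (U := T₁ * Q)
      (β := q₀ * (k + 2) * θ) (ε := Q / (M : ℝ) ^ (k + 1))
      (by nlinarith)
      (by
        refine le_trans ?_ hMbig.le
        rw [mul_pow, ← mul_assoc]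
        gcongr
        omega)
      (by positivity)
      (by
        rw [mul_div_assoc', div_mul_eq_mul_div, div_le_one (by positivity)]
        have h1 : 16 * Q * (T₁ * Q) ≤ M ^ 1 := by
          rw [pow_one]
          refine le_trans ?_ hMbig.le
          calc 16 * Q * (T₁ * Q) = 16 * T₁ ^ 1 * Q ^ 2 := by ring
            _ ≤ _ := by gcongr <;> omega
        have h2 := h1.trans (Nat.pow_le_pow_right hM (show 1 ≤ k + 1 by omega))
        exact_mod_cast h2)
      (by
        simp only [mem_image, mem_filter, hH, mem_range]
        rintro _ ⟨h, ⟨⟨hh, -⟩, -⟩, rfl⟩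
        omega)
      (by
        rw [card_image_of_injective _ (add_left_injective 1), mul_assoc]
        exact hHcard.trans (Nat.mul_le_mul_left _ hcard))
      (by
        simp only [mem_image, mem_filter]
        rintro _ ⟨h, ⟨hh, hhq⟩, rfl⟩
        have := (hq h hh).2.2
        rw [hhq] at this
        convert this using 2
        ring)
    refine ⟨q' * q₀ * (k + 2), Nat.mul_pos (Nat.mul_pos hq'1 hq₀.1) (by omega), ?_, ?_⟩
    · have h1 : k + 2 ≤ T ^ (k + 2) := (Nat.lt_two_pow_self).le.trans (Nat.pow_le_pow_left hT _)
      calc q' * q₀ * (k + 2) ≤ (2 * (T₁ * Q)) * Q * T ^ (k + 2) := by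
            gcongr
            exact hq₀.2
        _ ≤ (T * (T ^ 5 * T ^ (5 * K₀))) * T ^ (5 * K₀) * T ^ (k + 2) := by gcongr
        _ = T ^ (6 + 10 * K₀ + (k + 2)) := by ring
        _ ≤ _ := Nat.pow_le_pow_right hTpos (by nlinarith [Nat.zero_le (K₀ * k)])
    · have e : ((q' * q₀ * (k + 2) : ℕ) : ℝ) * θ = q' * (q₀ * (k + 2) * θ) := by
        push_cast
        ring
      rw [e]
      refine hq'3.trans ?_
      have e2 : 16 * ((Q : ℝ) / (M : ℝ) ^ (k + 1)) * ((T₁ * Q : ℕ) : ℝ) ^ 2 / M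
          = ((16 * T₁ ^ 2 * Q ^ 3 : ℕ) : ℝ) / (M : ℝ) ^ (k + 1 + 1) := by
        push_cast
        field_simp
        ring
      rw [e2]
      gcongr
      have h1 : T ^ (14 + 15 * K₀) ≤ T ^ ((14 + 15 * K₀) * (k + 2)) :=
        Nat.pow_le_pow_right hTpos (Nat.le_mul_of_pos_right _ (by omega))
      exact_mod_cast hbig.trans h1

lemma unitExp_sum {ι : Type*} (s : Finset ι) (f : ι → ℝ) :
    unitExp (∑ i ∈ s, f i) = ∏ i ∈ s, unitExp (f i) := by
  classical
  induction s using Finset.induction_on with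
  | empty => simp [unitExp_zero]
  | insert a s ha ih => rw [sum_insert ha, prod_insert ha, unitExp_add, ih]

lemma cos_pow_eq_sum_unitExp (R : ℕ) (x : ℝ) : ((Real.cos (Real.pi * x) ^ (2 * R) : ℝ) : ℂ)
    = ∑ j ∈ range (2 * R + 1), (((2 * R).choose j / 4 ^ R : ℝ) : ℂ)
        * unitExp (((j : ℤ) - R : ℤ) * x) := by
  have e : ((Real.cos (Real.pi * x) : ℝ) : ℂ) = (unitExp (x / 2) + unitExp (-(x / 2))) / 2 := by
    rw [unitExp, unitExp, Complex.ofReal_cos, Complex.cos]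
    push_cast
    ring_nf
  rw [Complex.ofReal_pow, e, div_pow, add_pow, sum_div]
  refine sum_congr rfl fun j hj => ?_
  have hj' : j ≤ 2 * R := Nat.lt_succ_iff.1 (mem_range.1 hj)
  rw [← unitExp_nat_mul, ← unitExp_nat_mul, ← unitExp_add, pow_mul]
  have e2 : (j : ℝ) * (x / 2) + ((2 * R - j : ℕ) : ℝ) * -(x / 2) = ((j : ℤ) - R : ℤ) * x := by
    push_cast [Nat.cast_sub hj']
    ring
  rw [e2]
  push_cast
  ring

/-- A positive-definite trigonometric polynomial concentrated near the lattice has large average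
along `y, 2 ^ k • y, …, M ^ k • y` when every relevant frequency is either almost constant or
equidistributed. -/
lemma exists_le_prod_cos_pow {d R M k : ℕ} {y : Fin d → ℝ} {η : ℝ} (hM : 1 ≤ M) (hη : 0 < η)
    (hη' : 2 * η * (2 * R + 1) ^ d ≤ 1)
    (h : ∀ r : Fin d → ℤ, (∀ i, |r i| ≤ R) →
      distInt (∑ i, r i * y i) ≤ 1 / (4 * (M : ℝ) ^ k) ∨
      ‖∑ m ∈ range M, unitExp (((m : ℝ) + 1) ^ k * ∑ i, r i * y i)‖ ≤ η * M) :
    ∃ m : ℕ, 1 ≤ m ∧ m ≤ M ∧ η ≤ ∏ i, Real.cos (Real.pi * ((m : ℝ) ^ k * y i)) ^ (2 * R) := by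
  have hMpos : (0 : ℝ) < M := by exact_mod_cast hM
  set w : (Fin d → ℕ) → ℝ := fun J => ∏ i, ((2 * R).choose (J i) / 4 ^ R : ℝ) with hw
  set B : Finset (Fin d → ℕ) := Fintype.piFinset fun _ => range (2 * R + 1) with hB
  have hw0 : ∀ J, 0 ≤ w J := fun J => prod_nonneg fun i _ => by positivity
  have hexp : ∀ x : Fin d → ℝ, ∏ i, Real.cos (Real.pi * x i) ^ (2 * R)
      = ∑ J ∈ B, w J * (unitExp (∑ i, ((J i : ℤ) - R : ℤ) * x i)).re := by
    intro x
    have e : ((∏ i, Real.cos (Real.pi * x i) ^ (2 * R) : ℝ) : ℂ)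
        = ∑ J ∈ B, (w J : ℂ) * unitExp (∑ i, ((J i : ℤ) - R : ℤ) * x i) := by
      rw [Complex.ofReal_prod]
      simp_rw [cos_pow_eq_sum_unitExp]
      rw [prod_univ_sum]
      refine sum_congr rfl fun J _ => ?_
      rw [prod_mul_distrib, unitExp_sum, hw, Complex.ofReal_prod]
    have e' := congrArg Complex.re e
    rw [Complex.ofReal_re, Complex.re_sum] at e'
    simpa only [Complex.re_ofReal_mul] using e'
  have hw1 : ∑ J ∈ B, w J = 1 := by
    have := hexp 0
    simpa [unitExp_zero] using this.symm
  set f : (Fin d → ℕ) → ℝ := fun J =>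
    (∑ m ∈ range M, unitExp (((m : ℝ) + 1) ^ k * ∑ i, ((J i : ℤ) - R : ℤ) * y i)).re with hf
  have htotal : ∑ m ∈ range M, ∏ i, Real.cos (Real.pi * (((m + 1 : ℕ) : ℝ) ^ k * y i)) ^ (2 * R)
      = ∑ J ∈ B, w J * f J := by
    simp_rw [hexp]
    rw [sum_comm]
    refine sum_congr rfl fun J _ => ?_
    rw [← mul_sum]
    simp only [hf, Complex.re_sum]
    congr 1
    refine sum_congr rfl fun m _ => ?_
    rw [mul_sum]
    congr 2
    refine sum_congr rfl fun i _ => ?_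
    push_cast
    ring
  have hfJ : ∀ J ∈ B, -(η * M) ≤ f J := by
    intro J hJ
    rw [hB, Fintype.mem_piFinset] at hJ
    rcases h (fun i => (J i : ℤ) - R) (fun i => by
      have := mem_range.1 (hJ i)
      rw [abs_le]
      constructor <;> omega) with h1 | h1
    · have : 0 ≤ f J := by
        simp only [hf, Complex.re_sum]
        refine sum_nonneg fun m hm => ?_
        rw [re_unitExp]
        apply cos_nonneg_of_distInt_le
        have e : ((m : ℝ) + 1) ^ k = (((m + 1) ^ k : ℕ) : ℝ) := by push_cast; rfl
        rw [e]
        refine (distInt_nat_mul_le _ _).trans ?_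
        have h2 : (((m + 1) ^ k : ℕ) : ℝ) ≤ (M : ℝ) ^ k := by
          exact_mod_cast Nat.pow_le_pow_left (mem_range.1 hm) k
        calc (((m + 1) ^ k : ℕ) : ℝ) * distInt (∑ i, ((fun i => (J i : ℤ) - R) i : ℤ) * y i)
            ≤ (M : ℝ) ^ k * (1 / (4 * (M : ℝ) ^ k)) :=
              mul_le_mul h2 h1 (distInt_nonneg _) (by positivity)
          _ = 1 / 4 := by field_simp
      have : 0 ≤ η * M := by positivity
      linarith
    · exact neg_le_of_abs_le ((Complex.abs_re_le_norm _).trans h1)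
  set J₀ : Fin d → ℕ := fun _ => R with hJ₀
  have hJ₀B : J₀ ∈ B := by
    rw [hB, Fintype.mem_piFinset]
    exact fun _ => mem_range.2 (by simp only [hJ₀]; omega)
  have hf0 : f J₀ = M := by simp [hf, hJ₀, unitExp_zero]
  have hwJ₀ : 2 * η ≤ w J₀ := by
    have h1 : (1 : ℝ) / (2 * R + 1) ≤ (2 * R).choose R / 4 ^ R := by
      rw [div_le_div_iff₀ (by positivity) (by positivity), one_mul, mul_comm]
      exact_mod_cast Nat.four_pow_le_two_mul_add_one_mul_central_binom R
    have h2 : w J₀ = ((2 * R).choose R / 4 ^ R : ℝ) ^ d := by simp [hw, hJ₀, div_pow]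
    rw [h2]
    calc 2 * η ≤ 1 / (2 * R + 1) ^ d := by rwa [le_div_iff₀ (by positivity)]
      _ = (1 / (2 * R + 1) : ℝ) ^ d := by rw [div_pow, one_pow]
      _ ≤ _ := pow_le_pow_left₀ (by positivity) h1 d
  have hlow : w J₀ * (f J₀ + η * M) ≤ ∑ J ∈ B, w J * (f J + η * M) :=
    single_le_sum (f := fun J => w J * (f J + η * M))
      (fun J hJ => mul_nonneg (hw0 J) (by linarith [hfJ J hJ])) hJ₀B
  have hsplit : ∑ J ∈ B, w J * (f J + η * M) = ∑ J ∈ B, w J * f J + η * M := by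
    simp_rw [mul_add]
    rw [sum_add_distrib, ← sum_mul, hw1, one_mul]
  rw [hsplit, hf0, ← htotal] at hlow
  have hge : ∑ m ∈ range M, η
      ≤ ∑ m ∈ range M, ∏ i, Real.cos (Real.pi * (((m + 1 : ℕ) : ℝ) ^ k * y i)) ^ (2 * R) := by
    rw [sum_const, card_range, nsmul_eq_mul]
    have : 0 < η * M := by positivity
    nlinarith [mul_le_mul_of_nonneg_right hwJ₀ hMpos.le]
  obtain ⟨m, hm, hle⟩ := exists_le_of_sum_le ⟨0, mem_range.2 hM⟩ hge
  exact ⟨m + 1, by omega, mem_range.1 hm, hle⟩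

lemma Matrix.natAbs_det_le {d R : ℕ} {B : Matrix (Fin d) (Fin d) ℤ} (hB : ∀ i j, |B i j| ≤ R) :
    B.det.natAbs ≤ d.factorial * R ^ d := by
  have := Matrix.det_le (A := B) (abv := AbsoluteValue.abs) (x := (R : ℤ)) hB
  simp only [AbsoluteValue.abs_apply, Fintype.card_fin, nsmul_eq_mul] at this
  rw [← Int.ofNat_le]
  simpa [Int.natCast_natAbs] using this

lemma abs_updateCol_le {d R : ℕ} {B : Matrix (Fin d) (Fin d) ℤ} (hB : ∀ i j, |B i j| ≤ R)
    {r : Fin d → ℤ} (hr : ∀ i, |r i| ≤ R) (j₀ i j : Fin d) : |B.updateCol j₀ r i j| ≤ R := by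
  rw [Matrix.updateCol_apply]
  split_ifs
  exacts [hr i, hB i j]

/-- Recurrence for `n ^ (k + 1)` on a torus: along some short `n`, a trigonometric polynomial
concentrated near the origin is not small. -/
lemma exists_prod_cos_pow_ge (k : ℕ) : ∃ K : ℕ, ∀ d R : ℕ, 1 ≤ d → 1 ≤ R → ∀ α : Fin d → ℝ,
    ∃ n : ℕ, 1 ≤ n ∧
      n ≤ (4 * d * (d.factorial * R ^ d) ^ (k + 1) * (2 * (2 * R + 1) ^ d) ^ K) ^ (d + 2) ∧
      1 / ((2 * (2 * R + 1) ^ d : ℕ) : ℝ)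
        ≤ ∏ i, Real.cos (Real.pi * ((n : ℝ) ^ (k + 1) * α i)) ^ (2 * R) := by
  obtain ⟨K, hK⟩ := weyl_inverse k
  refine ⟨K, fun d R hd hR α => ?_⟩
  set F := d.factorial * R ^ d with hF
  set T := 2 * (2 * R + 1) ^ d with hT
  set A := 4 * d * F ^ (k + 1) * T ^ K with hA
  have hFpos : 1 ≤ F := Nat.mul_pos d.factorial_pos (pow_pos hR d)
  have hT2 : 2 ≤ T := by
    have : 1 ≤ (2 * R + 1) ^ d := Nat.one_le_pow _ _ (by omega)
    omega
  have hTK : 1 ≤ T ^ K := Nat.one_le_pow _ _ (by omega)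
  have hEpos : 1 ≤ 4 * d * F ^ (k + 1) := Nat.mul_pos (by omega) (by positivity)
  have hApos : 1 ≤ A := Nat.mul_pos hEpos hTK
  have hFE : F ≤ 4 * d * F ^ (k + 1) := by
    calc F = 1 * F ^ 1 := by ring
      _ ≤ 4 * d * F ^ (k + 1) := by
        gcongr <;> omega
  have hFTA : F * T ^ K ≤ A := Nat.mul_le_mul_right _ hFE
  by_contra! hcon
  have hstep : ∀ s : ℕ, s ≤ d + 1 → ∃ q : ℕ, 1 ≤ q ∧ q ≤ A ^ s ∧
      ∃ B : Matrix (Fin d) (Fin d) ℤ, B.det ≠ 0 ∧ (∀ i j, |B i j| ≤ R) ∧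
      ∃ I : Finset (Fin d), #I = s ∧ ∀ j ∈ I, distInt ((q : ℝ) ^ (k + 1) * ∑ i, B i j * α i)
        ≤ 1 / ((4 * d * F ^ (k + 1) : ℕ) * ((A : ℝ) ^ (d + 1 - s)) ^ (k + 1)) := by
    intro s
    induction s with
    | zero =>
      refine fun _ => ⟨1, le_rfl, by simp, 1, by simp, fun i j => ?_, ∅, by simp, by simp⟩
      rw [Matrix.one_apply]
      split_ifs
      · simpa using hR
      · simp
    | succ s ih =>
      intro hs
      obtain ⟨q, hq1, hqA, B, hdet, hBR, I, hI, hIq⟩ := ih (by omega)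
      set D := B.det.natAbs with hD
      have hD1 : 1 ≤ D := Int.natAbs_pos.2 hdet
      have hDF : D ≤ F := Matrix.natAbs_det_le hBR
      set M := A ^ (d + 1 - s) with hM
      set M' := A ^ (d - s) with hM'
      have hMM' : M = A * M' := by
        rw [hM, hM', ← pow_succ']
        congr 1
        omega
      have hM1 : 1 ≤ M := Nat.one_le_pow _ _ hApos
      have hM'1 : 1 ≤ M' := Nat.one_le_pow _ _ hApos
      set y : Fin d → ℝ := fun i => ((q * D : ℕ) : ℝ) ^ (k + 1) * α i with hy
      have hTη : 2 * (1 / (T : ℝ)) * (2 * R + 1) ^ d ≤ 1 := by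
        rw [hT]
        push_cast
        field_simp
        exact le_rfl
      obtain ⟨r, hrR, hr1, hr2⟩ : ∃ r : Fin d → ℤ, (∀ i, |r i| ≤ R) ∧
          1 / (4 * (M : ℝ) ^ (k + 1)) < distInt (∑ i, r i * y i) ∧
          1 / (T : ℝ) * M <
            ‖∑ m ∈ range M, unitExp (((m : ℝ) + 1) ^ (k + 1) * ∑ i, r i * y i)‖ := by
        by_contra! hno
        obtain ⟨m, hm1, hmM, hm⟩ := exists_le_prod_cos_pow hM1 (by positivity) hTη
          (fun r hr => (le_or_gt _ _).imp_right (hno r hr))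
        refine absurd hm (not_le.2 ?_)
        have h1 : q * D * m ≤ A ^ (d + 2) := by
          calc q * D * m ≤ A ^ s * A * A ^ (d + 1 - s) := by
                gcongr
                exact hDF.trans (hFE.trans (Nat.le_mul_of_pos_right _ hTK))
            _ = A ^ (d + 2) := by
                rw [← pow_succ, ← pow_add]
                congr 1
                omega
        have h2 := hcon (q * D * m) (Nat.mul_pos (Nat.mul_pos hq1 hD1) hm1) h1
        convert h2 using 5 with i
        simp only [hy]
        push_cast
        ring
      set x := ∑ i, r i * y i with hx
      have hxα : x = ((q * D : ℕ) : ℝ) ^ (k + 1) * ∑ i, r i * α i := by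
        rw [hx, mul_sum]
        exact sum_congr rfl fun i _ => by simp only [hy]; ring
      obtain ⟨q', hq'1, hq'T, hq'⟩ := hK T hT2 M M le_rfl hM1
        (Polynomial.C x * (Polynomial.X + Polynomial.C 1) ^ (k + 1))
        (by
          refine (Polynomial.natDegree_C_mul_le _ _).trans ?_
          rw [Polynomial.natDegree_pow_X_add_C])
        (by
          simp only [Polynomial.eval_mul, Polynomial.eval_C, Polynomial.eval_pow,
            Polynomial.eval_add, Polynomial.eval_X]
          simp only [mul_comm x]
          have : (0 : ℝ) < T := by positivity
          rw [one_div, inv_mul_lt_iff₀ this] at hr2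
          exact hr2.le)
      have hcoeff : (Polynomial.C x * (Polynomial.X + Polynomial.C 1) ^ (k + 1)).coeff (k + 1)
          = x := by
        rw [Polynomial.coeff_C_mul, Polynomial.coeff_X_add_C_pow]
        simp
      rw [hcoeff] at hq'
      set c := B.cramer r with hc
      have hcF : ∀ j, (c j).natAbs ≤ F := by
        intro j
        rw [hc, Matrix.cramer_apply]
        exact Matrix.natAbs_det_le (abs_updateCol_le hBR hrR j)
      set E := 4 * d * F ^ (k + 1) with hE
      have hEpos' : (0 : ℝ) < E := by exact_mod_cast hEpos
      have hMpos' : (0 : ℝ) < M := by exact_mod_cast hM1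
      have hM'pos' : (0 : ℝ) < M' := by exact_mod_cast hM'1
      have hMcast : (A : ℝ) ^ (d + 1 - s) = M := by rw [hM]; push_cast; rfl
      have hM'cast : (A : ℝ) ^ (d + 1 - (s + 1)) = M' := by
        rw [hM', show d + 1 - (s + 1) = d - s by omega]; push_cast; rfl
      rw [hMcast] at hIq
      obtain ⟨j₀, hj₀I, hj₀⟩ : ∃ j₀, j₀ ∉ I ∧ c j₀ ≠ 0 := by
        by_contra! hno
        refine absurd hr1 (not_lt.2 ?_)
        have e1 : (B.det : ℝ) * ∑ i, r i * α i = ∑ j ∈ I, c j * ∑ i, B i j * α i := by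
          have e0 := Matrix.mulVec_cramer B r
          rw [sum_subset (subset_univ I) (fun j _ hj => by rw [hno j hj]; simp)]
          simp_rw [mul_sum]
          rw [sum_comm]
          refine sum_congr rfl fun i _ => ?_
          have e2 : (B.det : ℝ) * r i = ∑ j, (B i j : ℝ) * c j := by
            have e3 := congrFun e0 i
            rw [Pi.smul_apply, smul_eq_mul, Matrix.mulVec, dotProduct] at e3
            exact_mod_cast e3.symm
          rw [← mul_assoc, e2, sum_mul]
          exact sum_congr rfl fun j _ => by ring
        have e2 : distInt x = distInt ((D ^ k : ℕ) * ∑ j ∈ I, c j *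
            ((q : ℝ) ^ (k + 1) * ∑ i, B i j * α i)) := by
          have e3 : ∑ j ∈ I, c j * ((q : ℝ) ^ (k + 1) * ∑ i, B i j * α i)
              = (q : ℝ) ^ (k + 1) * (B.det * ∑ i, r i * α i) := by
            rw [e1, mul_sum]
            exact sum_congr rfl fun j _ => by ring
          rw [e3, hxα]
          have e4 : (D : ℝ) = |(B.det : ℝ)| := by
            rw [hD, Nat.cast_natAbs, Int.cast_abs]
          generalize (B.det : ℝ) = δ at e4 ⊢
          rcases abs_choice δ with h | h
          · congr 1
            rw [h] at e4
            push_cast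
            rw [← e4]
            ring
          · rw [← distInt_neg]
            congr 1
            rw [h] at e4
            rw [show δ = -D by linarith]
            push_cast
            ring
        rw [e2]
        refine (distInt_nat_mul_le _ _).trans ?_
        have h3 : distInt (∑ j ∈ I, c j * ((q : ℝ) ^ (k + 1) * ∑ i, B i j * α i))
            ≤ d * (F * (1 / (E * (M : ℝ) ^ (k + 1)))) := by
          refine (distInt_sum_le _ _).trans ((sum_le_card_nsmul I _
            (F * (1 / (E * (M : ℝ) ^ (k + 1)))) fun j hj => ?_).trans ?_)
          · refine (distInt_int_mul_le _ _).trans ?_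
            refine mul_le_mul ?_ (hIq j hj) (distInt_nonneg _) (by positivity)
            rw [← Int.cast_abs, ← Nat.cast_natAbs]
            exact_mod_cast hcF j
          · rw [nsmul_eq_mul]
            gcongr
            exact (card_le_univ I).trans (by simp)
        calc ((D ^ k : ℕ) : ℝ) * distInt (∑ j ∈ I, c j * ((q : ℝ) ^ (k + 1) * ∑ i, B i j * α i))
            ≤ ((F ^ k : ℕ) : ℝ) * (d * (F * (1 / (E * (M : ℝ) ^ (k + 1))))) := by
              refine mul_le_mul ?_ h3 (distInt_nonneg _) (by positivity)
              exact_mod_cast Nat.pow_le_pow_left hDF k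
          _ = 1 / (4 * (M : ℝ) ^ (k + 1)) := by
              have : (0 : ℝ) < F := by exact_mod_cast hFpos
              have : (0 : ℝ) < d := by exact_mod_cast hd
              rw [hE]
              push_cast
              field_simp
              ring
      refine ⟨q * D * q', Nat.mul_pos (Nat.mul_pos hq1 hD1) hq'1, ?_, B.updateCol j₀ r, ?_,
        abs_updateCol_le hBR hrR j₀, insert j₀ I, ?_, ?_⟩
      · calc q * D * q' = q * (D * q') := by ring
          _ ≤ A ^ s * (F * T ^ K) := by gcongr
          _ ≤ A ^ s * A := by gcongr
          _ = A ^ (s + 1) := by ring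
      · rwa [← Matrix.cramer_apply]
      · rw [card_insert_of_notMem hj₀I, hI]
      · rw [hM'cast]
        intro j hj
        rw [mem_insert] at hj
        have hMr : (M : ℝ) = A * M' := by exact_mod_cast hMM'
        have hAposr : (0 : ℝ) < A := by exact_mod_cast hApos
        by_cases hjj : j = j₀
        · subst hjj
          simp only [Matrix.updateCol_self]
          have e1 : ((q * D * q' : ℕ) : ℝ) ^ (k + 1) * ∑ i, r i * α i
              = ((q' ^ k : ℕ) : ℝ) * (q' * x) := by
            rw [hxα]
            push_cast
            ring
          rw [e1]
          refine (distInt_nat_mul_le _ _).trans ?_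
          calc ((q' ^ k : ℕ) : ℝ) * distInt (q' * x)
              ≤ (((T ^ K) ^ k : ℕ) : ℝ) * ((T : ℝ) ^ K / (M : ℝ) ^ (k + 1)) := by
                refine mul_le_mul ?_ hq' (distInt_nonneg _) (by positivity)
                exact_mod_cast Nat.pow_le_pow_left hq'T k
            _ = (((T ^ K) ^ (k + 1) : ℕ) : ℝ) / (M : ℝ) ^ (k + 1) := by
                push_cast
                ring
            _ ≤ 1 / (E * (M' : ℝ) ^ (k + 1)) := by
                rw [div_le_div_iff₀ (by positivity) (by positivity), hMr, one_mul]
                have h1 : (T ^ K) ^ (k + 1) * E ≤ A ^ (k + 1) := by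
                  rw [hA, mul_pow E, mul_comm]
                  exact Nat.mul_le_mul_right _ (Nat.le_self_pow (by omega) E)
                have h2 : (((T ^ K) ^ (k + 1) : ℕ) : ℝ) * E ≤ (A : ℝ) ^ (k + 1) := by
                  exact_mod_cast h1
                calc _ = ((((T ^ K) ^ (k + 1) : ℕ) : ℝ) * E) * (M' : ℝ) ^ (k + 1) :=
                      (mul_assoc _ _ _).symm
                  _ ≤ _ := mul_le_mul_of_nonneg_right h2 (by positivity)
                  _ = _ := (mul_pow _ _ _).symm
        · have hjI : j ∈ I := hj.resolve_left hjj
          simp only [Matrix.updateCol_ne hjj]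
          have e1 : ((q * D * q' : ℕ) : ℝ) ^ (k + 1) * ∑ i, B i j * α i
              = (((D * q') ^ (k + 1) : ℕ) : ℝ) * ((q : ℝ) ^ (k + 1) * ∑ i, B i j * α i) := by
            push_cast
            ring
          rw [e1]
          refine (distInt_nat_mul_le _ _).trans ?_
          calc (((D * q') ^ (k + 1) : ℕ) : ℝ) * distInt ((q : ℝ) ^ (k + 1) * ∑ i, B i j * α i)
              ≤ ((A ^ (k + 1) : ℕ) : ℝ) * (1 / (E * (M : ℝ) ^ (k + 1))) := by
                refine mul_le_mul ?_ (hIq j hjI) (distInt_nonneg _) (by positivity)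
                exact_mod_cast Nat.pow_le_pow_left
                  ((Nat.mul_le_mul hDF hq'T).trans hFTA) (k + 1)
            _ = 1 / (E * (M' : ℝ) ^ (k + 1)) := by
                rw [hMr]
                push_cast
                field_simp
                ring
  obtain ⟨-, -, -, -, -, -, I, hI, -⟩ := hstep (d + 1) le_rfl
  have := card_le_univ I
  rw [hI, Fintype.card_fin] at this
  omega

lemma four_mul_sq_mul_le_of_prod_cos_pow {d R : ℕ} {T : ℝ} (hT : 0 < T) {x : Fin d → ℝ}
    (h : 1 / T ≤ ∏ i, Real.cos (Real.pi * x i) ^ (2 * R)) (i : Fin d) :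
    Real.exp (4 * distInt (x i) ^ 2 * R) ≤ T := by
  have h1 : ∏ i, Real.cos (Real.pi * x i) ^ (2 * R) ≤ Real.cos (Real.pi * x i) ^ (2 * R) := by
    rw [← mul_prod_erase univ _ (mem_univ i)]
    refine mul_le_of_le_one_right ?_ (prod_le_one (fun j _ => ?_) fun j _ => ?_)
    · rw [pow_mul]; positivity
    · rw [pow_mul]; positivity
    · rw [pow_mul]
      exact pow_le_one₀ (sq_nonneg _) (Real.cos_sq_le_one _)
  have h2 : Real.cos (Real.pi * x i) ^ (2 * R) ≤ Real.exp (-(4 * distInt (x i) ^ 2 * R)) := by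
    rw [pow_mul, ← neg_mul, mul_comm _ (R : ℝ), Real.exp_nat_mul]
    refine pow_le_pow_left₀ (sq_nonneg _) ((cos_sq_le _).trans ?_) R
    linarith [Real.add_one_le_exp (-(4 * distInt (x i) ^ 2))]
  have h3 := h.trans (h1.trans h2)
  rw [Real.exp_neg, one_div] at h3
  exact (inv_le_inv₀ hT (Real.exp_pos _)).1 h3

/-- Simultaneous recurrence for `n ^ (k + 1)` at scale `S`. -/
lemma exists_distInt_pow_mul_le (k : ℕ) : ∃ D : ℕ, 1 ≤ D ∧ ∀ d S : ℕ, 1 ≤ d → 2 ≤ S → d ≤ S →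
    ∀ α : Fin d → ℝ, ∃ n : ℕ, 1 ≤ n ∧ n ≤ S ^ (D * d ^ 2) ∧
      ∀ i, distInt ((n : ℝ) ^ (k + 1) * α i) ≤ 2 / S := by
  obtain ⟨K, hK⟩ := exists_prod_cos_pow_ge k
  refine ⟨3 * (3 + 5 * (k + 1) + 7 * K), by omega, fun d S hd hS hdS α => ?_⟩
  obtain ⟨n, hn1, hn, h⟩ := hK d (S ^ 4) hd (Nat.one_le_pow _ _ (by omega)) α
  have hpow : ∀ a b, a ≤ b → S ^ a ≤ S ^ b := fun a b h => Nat.pow_le_pow_right (by omega) h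
  have hT : 2 * (2 * S ^ 4 + 1) ^ d ≤ S ^ (7 * d) := by
    have h1 : 2 * S ^ 4 + 1 ≤ S ^ 6 := by
      have h2 : 1 ≤ S ^ 4 := Nat.one_le_pow _ _ (by omega)
      have h3 : 2 * 2 ≤ S * S := Nat.mul_le_mul hS hS
      calc 2 * S ^ 4 + 1 ≤ 2 * 2 * S ^ 4 := by omega
        _ ≤ S * S * S ^ 4 := Nat.mul_le_mul_right _ h3
        _ = S ^ 6 := by ring
    calc 2 * (2 * S ^ 4 + 1) ^ d ≤ S * (S ^ 6) ^ d := by gcongr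
      _ = S ^ (6 * d + 1) := by ring
      _ ≤ _ := hpow _ _ (by omega)
  have hF : d.factorial * (S ^ 4) ^ d ≤ S ^ (5 * d) := by
    calc d.factorial * (S ^ 4) ^ d ≤ S ^ d * (S ^ 4) ^ d := by
          gcongr
          exact (Nat.factorial_le_pow d).trans (Nat.pow_le_pow_left hdS d)
      _ = _ := by ring
  have hd4 : 4 * d ≤ S ^ (3 * d) := by
    calc 4 * d ≤ S ^ 2 * S := by
          refine Nat.mul_le_mul ?_ hdS
          nlinarith
      _ = S ^ 3 := by ring
      _ ≤ _ := hpow _ _ (by omega)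
  refine ⟨n, hn1, hn.trans ?_, fun i => ?_⟩
  · calc _ ≤ (S ^ (3 * d) * (S ^ (5 * d)) ^ (k + 1) * (S ^ (7 * d)) ^ K) ^ (d + 2) := by gcongr
      _ = S ^ (d * (3 + 5 * (k + 1) + 7 * K) * (d + 2)) := by
        rw [← pow_mul, ← pow_mul, ← pow_add, ← pow_add, ← pow_mul]
        ring_nf
      _ ≤ S ^ (d * (3 + 5 * (k + 1) + 7 * K) * (3 * d)) := hpow _ _ (by gcongr; omega)
      _ = _ := by ring_nf
  · have h1 := four_mul_sq_mul_le_of_prod_cos_pow (by positivity) h i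
    set t := distInt ((n : ℝ) ^ (k + 1) * α i) with ht
    have hS0 : (0 : ℝ) < S := by positivity
    have h2 : Real.exp (4 * t ^ 2 * (S ^ 4 : ℕ)) ≤ Real.exp ((7 * d : ℕ) * S) := by
      refine h1.trans ?_
      rw [Real.exp_nat_mul]
      calc ((2 * (2 * S ^ 4 + 1) ^ d : ℕ) : ℝ) ≤ (S ^ (7 * d) : ℕ) := by exact_mod_cast hT
        _ = (S : ℝ) ^ (7 * d) := by push_cast; rfl
        _ ≤ _ := pow_le_pow_left₀ hS0.le (by linarith [Real.add_one_le_exp (S : ℝ)]) _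
    have h3 := Real.exp_le_exp.1 h2
    push_cast at h3
    have h4 : (d : ℝ) ≤ S := by exact_mod_cast hdS
    have h5 : (t * S) ^ 2 ≤ 2 ^ 2 := by
      have h6 : 4 * (t * S) ^ 2 * (S : ℝ) ^ 2 ≤ 7 * (S : ℝ) ^ 2 := by
        calc 4 * (t * S) ^ 2 * (S : ℝ) ^ 2 = 4 * t ^ 2 * (S : ℝ) ^ 4 := by ring
          _ ≤ 7 * (d : ℝ) * S := h3
          _ ≤ 7 * (S : ℝ) * S := by gcongr
          _ = _ := by ring
      have := le_of_mul_le_mul_right h6 (by positivity)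
      linarith
    rw [le_div_iff₀ hS0]
    exact (sq_le_sq₀ (mul_nonneg (distInt_nonneg _) hS0.le) (by norm_num)).1 h5

/-- Simultaneous polynomial recurrence with a power-saving bound. -/
lemma exists_distInt_pow_mul_le_rpow (k : ℕ) : ∃ c : ℝ, 0 < c ∧ c ≤ 1 ∧ ∀ d N : ℕ, 1 ≤ d → 1 ≤ N →
    ∀ α : Fin d → ℝ, ∃ n : ℕ, 1 ≤ n ∧ n ≤ N ∧
      ∀ i, distInt ((n : ℝ) ^ (k + 1) * α i) ≤ 4 * (N : ℝ) ^ (-(c / (d : ℝ) ^ 3)) := by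
  obtain ⟨D, hD, h⟩ := exists_distInt_pow_mul_le k
  have hD0 : (0 : ℝ) < D := by exact_mod_cast hD
  refine ⟨1 / D, by positivity, by rw [div_le_one hD0]; exact_mod_cast hD,
    fun d N hd hN α => ?_⟩
  have hd0 : (0 : ℝ) < d := by exact_mod_cast hd
  have hd1 : (1 : ℝ) ≤ d := by exact_mod_cast hd
  have hN0 : (0 : ℝ) < N := by exact_mod_cast hN
  have hN1 : (1 : ℝ) ≤ N := by exact_mod_cast hN
  set y : ℝ := (N : ℝ) ^ (1 / (D * d ^ 2 : ℝ)) with hy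
  have hy0 : 0 < y := by positivity
  have hyd : (N : ℝ) ^ (1 / D / (d : ℝ) ^ 3) = y ^ (1 / (d : ℝ)) := by
    rw [hy, ← Real.rpow_mul hN0.le]
    congr 1
    field_simp
  rcases lt_or_ge y (d + 1) with hlt | hge
  · refine ⟨1, le_rfl, hN, fun i => (distInt_le_half _).trans ?_⟩
    have h1 : (N : ℝ) ^ (1 / D / (d : ℝ) ^ 3) ≤ 2 := by
      rw [hyd]
      have h2 : y ≤ (2 : ℝ) ^ (d : ℝ) := by
        rw [Real.rpow_natCast]
        refine hlt.le.trans ?_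
        exact_mod_cast Nat.lt_two_pow_self (n := d)
      calc y ^ (1 / (d : ℝ)) ≤ ((2 : ℝ) ^ (d : ℝ)) ^ (1 / (d : ℝ)) :=
            Real.rpow_le_rpow hy0.le h2 (by positivity)
        _ = 2 := by
          rw [← Real.rpow_mul (by norm_num), mul_one_div_cancel hd0.ne', Real.rpow_one]
    rw [Real.rpow_neg hN0.le]
    have h3 : (2 : ℝ)⁻¹ ≤ ((N : ℝ) ^ (1 / D / (d : ℝ) ^ 3))⁻¹ :=
      inv_anti₀ (by positivity) h1
    linarith
  · set S := ⌊y⌋₊ with hS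
    have hSd : d + 1 ≤ S := Nat.le_floor (by exact_mod_cast hge)
    obtain ⟨n, hn1, hn, hle⟩ := h d S hd (by omega) (by omega) α
    have hSy : (S : ℝ) ≤ y := Nat.floor_le hy0.le
    refine ⟨n, hn1, ?_, fun i => (hle i).trans ?_⟩
    · have h1 : ((S ^ (D * d ^ 2) : ℕ) : ℝ) ≤ N := by
        push_cast
        calc (S : ℝ) ^ (D * d ^ 2) ≤ y ^ (D * d ^ 2) := pow_le_pow_left₀ (by positivity) hSy _
          _ = N := by
            rw [hy, ← Real.rpow_natCast, ← Real.rpow_mul hN0.le]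
            push_cast
            rw [one_div_mul_cancel (by positivity), Real.rpow_one]
      exact hn.trans (by exact_mod_cast h1)
    · have hS0 : (0 : ℝ) < S := by exact_mod_cast (by omega : 0 < S)
      have h1 : y ≤ 2 * S := by
        have h2 := Nat.lt_floor_add_one y
        have h3 : (1 : ℝ) ≤ S := by exact_mod_cast (by omega : 1 ≤ S)
        rw [← hS] at h2
        linarith
      have h4 : (N : ℝ) ^ (1 / D / (d : ℝ) ^ 3) ≤ y := by
        rw [hy]
        refine Real.rpow_le_rpow_of_exponent_le hN1 ?_
        rw [div_div]
        refine one_div_le_one_div_of_le (by positivity) ?_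
        exact mul_le_mul_of_nonneg_left (pow_le_pow_right₀ hd1 (by norm_num)) hD0.le
      rw [Real.rpow_neg hN0.le, ← div_eq_mul_inv, div_le_div_iff₀ hS0 (by positivity)]
      linarith

/-- `s` splits into at most `L` arithmetic progressions on each of which every `Q i` varies by at
most `ε` modulo `1`. -/
def HasAPPartition {ι : Type*} (Q : ι → ℕ → ℝ) (s : Finset ℕ) (L : ℕ) (ε : ℝ) : Prop :=
  ∃ F : Finset (Finset ℕ),
    (∀ P ∈ F, ∃ a q m : ℕ, 1 ≤ q ∧ P = (range m).image fun t => a + t * q) ∧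
    (∀ P ∈ F, ∀ P' ∈ F, P ≠ P' → Disjoint P P') ∧
    F.biUnion id = s ∧ #F ≤ L ∧
    ∀ P ∈ F, ∀ i, ∀ n ∈ P, ∀ n' ∈ P, distInt (Q i n - Q i n') ≤ ε

namespace HasAPPartition

variable {ι : Type*} {Q Q' : ι → ℕ → ℝ} {s t : Finset ℕ} {L L' : ℕ} {ε ε' : ℝ}

lemma mono (h : HasAPPartition Q s L ε) (hL : L ≤ L') (hε : ε ≤ ε') :
    HasAPPartition Q s L' ε' := by
  obtain ⟨F, h1, h2, h3, h4, h5⟩ := h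
  exact ⟨F, h1, h2, h3, h4.trans hL, fun P hP i n hn n' hn' => (h5 P hP i n hn n' hn').trans hε⟩

lemma singletons (Q : ι → ℕ → ℝ) (s : Finset ℕ) (hε : 0 ≤ ε) : HasAPPartition Q s #s ε := by
  refine ⟨s.image singleton, ?_, ?_, ?_, card_image_le, ?_⟩
  · simp only [mem_image]
    rintro _ ⟨n, -, rfl⟩
    exact ⟨n, 1, 1, le_rfl, by simp⟩
  · simp only [mem_image]
    rintro _ ⟨n, -, rfl⟩ _ ⟨n', -, rfl⟩ hne
    rw [disjoint_singleton]
    rintro rfl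
    exact hne rfl
  · ext n
    simp
  · simp only [mem_image]
    rintro _ ⟨n, -, rfl⟩ i n₁ hn₁ n₂ hn₂
    rw [mem_singleton] at hn₁ hn₂
    simpa [hn₁, hn₂, distInt] using hε

lemma union (hs : HasAPPartition Q s L ε) (ht : HasAPPartition Q t L' ε) (hst : Disjoint s t) :
    HasAPPartition Q (s ∪ t) (L + L') ε := by
  obtain ⟨F, h1, h2, rfl, h4, h5⟩ := hs
  obtain ⟨F', h1', h2', rfl, h4', h5'⟩ := ht
  have hd : ∀ P ∈ F, ∀ P' ∈ F', Disjoint P P' := fun P hP P' hP' =>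
    hst.mono (subset_biUnion_of_mem id hP) (subset_biUnion_of_mem id hP')
  refine ⟨F ∪ F', ?_, ?_, union_biUnion, (card_union_le _ _).trans (by omega), ?_⟩
  · exact fun P hP => (mem_union.1 hP).elim (h1 P) (h1' P)
  · intro P hP P' hP' hne
    rcases mem_union.1 hP with hP | hP <;> rcases mem_union.1 hP' with hP' | hP'
    exacts [h2 P hP P' hP' hne, hd P hP P' hP', (hd P' hP' P hP).symm, h2' P hP P' hP' hne]
  · exact fun P hP => (mem_union.1 hP).elim (h5 P) (h5' P)

lemma biUnion {κ : Type*} [DecidableEq κ] {J : Finset κ} {f : κ → Finset ℕ}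
    (h : ∀ j ∈ J, HasAPPartition Q (f j) L ε)
    (hf : ∀ j ∈ J, ∀ j' ∈ J, j ≠ j' → Disjoint (f j) (f j')) :
    HasAPPartition Q (J.biUnion f) (#J * L) ε := by
  induction J using Finset.induction_on with
  | empty => exact ⟨∅, by simp⟩
  | insert a J ha ih =>
    rw [biUnion_insert, card_insert_of_notMem ha, add_mul, one_mul, add_comm]
    refine (h a (mem_insert_self _ _)).union (ih (fun j hj => h j (mem_insert_of_mem hj))
      fun j hj j' hj' => hf j (mem_insert_of_mem hj) j' (mem_insert_of_mem hj')) ?_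
    rw [disjoint_biUnion_right]
    exact fun j hj => hf a (mem_insert_self _ _) j (mem_insert_of_mem hj)
      fun e => ha (e ▸ hj)

lemma image {a q : ℕ} (hq : 1 ≤ q) (h : HasAPPartition (fun i n => Q i (a + q * n)) s L ε) :
    HasAPPartition Q (s.image fun n => a + q * n) L ε := by
  obtain ⟨F, h1, h2, rfl, h4, h5⟩ := h
  have hinj : Function.Injective fun n => a + q * n := fun x y hxy =>
    Nat.eq_of_mul_eq_mul_left hq (Nat.add_left_cancel hxy)
  refine ⟨F.image fun P => P.image fun n => a + q * n, ?_, ?_, ?_, card_image_le.trans h4, ?_⟩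
  · simp only [mem_image]
    rintro _ ⟨P, hP, rfl⟩
    obtain ⟨b, r, m, hr, rfl⟩ := h1 P hP
    refine ⟨a + q * b, q * r, m, Nat.mul_pos hq hr, ?_⟩
    rw [image_image]
    congr 1
    ext t
    simp only [Function.comp_apply]
    ring
  · simp only [mem_image]
    rintro _ ⟨P, hP, rfl⟩ _ ⟨P', hP', rfl⟩ hne
    rw [disjoint_image hinj]
    exact h2 P hP P' hP' fun e => hne (e ▸ rfl)
  · rw [image_biUnion, biUnion_image]
    rfl
  · simp only [mem_image]
    rintro _ ⟨P, hP, rfl⟩ i n hn n' hn'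
    obtain ⟨x, hx, rfl⟩ := mem_image.1 hn
    obtain ⟨x', hx', rfl⟩ := mem_image.1 hn'
    exact h5 P hP i x hx x' hx'

lemma of_distInt_sub_le (h : HasAPPartition Q' s L ε)
    (hQ : ∀ i, ∀ n ∈ s, ∀ n' ∈ s, distInt ((Q i n - Q' i n) - (Q i n' - Q' i n')) ≤ ε') :
    HasAPPartition Q s L (ε + ε') := by
  obtain ⟨F, h1, h2, rfl, h4, h5⟩ := h
  refine ⟨F, h1, h2, rfl, h4, fun P hP i n hn n' hn' => ?_⟩
  have e : Q i n - Q i n' = (Q' i n - Q' i n') + ((Q i n - Q' i n) - (Q i n' - Q' i n')) := by ring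
  rw [e]
  exact (distInt_add_le _ _).trans (add_le_add (h5 P hP i n hn n' hn')
    (hQ i n (mem_biUnion.2 ⟨P, hP, hn⟩) n' (mem_biUnion.2 ⟨P, hP, hn'⟩)))

/-- Cut `range N` into progressions of step `q` and length `m`, and partition each of them. -/
lemma range_of_blocks {N q m : ℕ} (hq : 1 ≤ q) (hm : 1 ≤ m) (hε : 0 ≤ ε)
    (h : ∀ a, HasAPPartition (fun i n => Q i (a + q * n)) (range m) L ε) :
    HasAPPartition Q (range N) (N / m * L + q * m) ε := by
  set B := N / (q * m) with hB
  have hqm : 0 < q * m := Nat.mul_pos hq hm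
  have hBN : q * m * B ≤ N := Nat.mul_div_le _ _
  set f : ℕ × ℕ → Finset ℕ := fun p => (range m).image fun n => (p.1 + q * (m * p.2)) + q * n
    with hf
  have key : ∀ p ∈ range q ×ˢ range B, ∀ x ∈ f p, x % q = p.1 ∧ x / q / m = p.2 := by
    rintro ⟨r, b⟩ hp x hx
    simp only [mem_product, mem_range] at hp
    obtain ⟨n, hn, rfl⟩ := mem_image.1 hx
    have hn := mem_range.1 hn
    have e : (r + q * (m * b)) + q * n = r + q * (n + m * b) := by ring
    simp only [e]
    rw [Nat.add_mul_mod_self_left, Nat.mod_eq_of_lt hp.1, Nat.add_mul_div_left _ _ hq,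
      Nat.div_eq_of_lt hp.1, zero_add, Nat.add_mul_div_left _ _ hm, Nat.div_eq_of_lt hn, zero_add]
    exact ⟨rfl, rfl⟩
  have hunion : (range q ×ˢ range B).biUnion f = range (q * m * B) := by
    ext x
    simp only [mem_biUnion, mem_range, mem_product]
    constructor
    · rintro ⟨⟨r, b⟩, ⟨hr, hb⟩, hx⟩
      obtain ⟨n, hn, rfl⟩ := mem_image.1 hx
      have hn := mem_range.1 hn
      dsimp only at *
      have h1 : m * b + n + 1 ≤ m * B := by
        calc m * b + n + 1 ≤ m * b + m := by omega
          _ = m * (b + 1) := by ring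
          _ ≤ m * B := Nat.mul_le_mul_left _ hb
      calc r + q * (m * b) + q * n < q + q * (m * b) + q * n := by omega
        _ = q * (m * b + n + 1) := by ring
        _ ≤ q * (m * B) := Nat.mul_le_mul_left _ h1
        _ = _ := by ring
    · intro hx
      refine ⟨(x % q, x / q / m), ⟨Nat.mod_lt _ hq, ?_⟩, ?_⟩
      · rw [Nat.div_div_eq_div_mul]
        exact Nat.div_lt_of_lt_mul hx
      · refine mem_image.2 ⟨x / q % m, mem_range.2 (Nat.mod_lt _ hm), ?_⟩
        dsimp only
        rw [add_assoc, ← mul_add, Nat.div_add_mod, Nat.mod_add_div]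
  have h1 : HasAPPartition Q (range (q * m * B)) (#(range q ×ˢ range B) * L) ε := by
    rw [← hunion]
    refine biUnion (fun p _ => (h _).image hq) fun p hp p' hp' hne => ?_
    rw [disjoint_left]
    intro x hx hx'
    have k1 := key p hp x hx
    have k2 := key p' hp' x hx'
    exact hne (Prod.ext (k1.1.symm.trans k2.1) (k1.2.symm.trans k2.2))
  have h2 : range N = range (q * m * B) ∪ Ico (q * m * B) N := by
    rw [range_eq_Ico, range_eq_Ico, Ico_union_Ico_eq_Ico (Nat.zero_le _) hBN]
  rw [h2]
  refine (h1.union (singletons Q _ hε) ?_).mono (add_le_add (Nat.mul_le_mul_right _ ?_) ?_) le_rfl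
  · rw [range_eq_Ico]
    exact Ico_disjoint_Ico_consecutive _ _ _
  · rw [card_product, card_range, card_range, Nat.le_div_iff_mul_le hm]
    calc q * B * m = q * m * B := by ring
      _ ≤ N := hBN
  · rw [Nat.card_Ico, ← Nat.mod_eq_sub_mul_div]
    exact (Nat.mod_lt _ hqm).le

end HasAPPartition

lemma natDegree_comp_linear_le {P : ℝ[X]} {k : ℕ} (hP : P.natDegree ≤ k) (q a : ℝ) :
    (P.comp (Polynomial.C q * Polynomial.X + Polynomial.C a)).natDegree ≤ k := by
  refine Polynomial.natDegree_comp_le.trans ?_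
  calc _ ≤ k * 1 := Nat.mul_le_mul hP Polynomial.natDegree_linear_le
    _ = k := mul_one k

lemma coeff_comp_linear {P : ℝ[X]} {k : ℕ} (hP : P.natDegree ≤ k) {q : ℝ} (hq : q ≠ 0) (a : ℝ) :
    (P.comp (Polynomial.C q * Polynomial.X + Polynomial.C a)).coeff k = q ^ k * P.coeff k := by
  rcases hP.lt_or_eq with h | rfl
  · rw [Polynomial.coeff_eq_zero_of_natDegree_lt h, mul_zero]
    exact Polynomial.coeff_eq_zero_of_natDegree_lt
      ((natDegree_comp_linear_le le_rfl q a).trans_lt h)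
  · have h1 := Polynomial.natDegree_linear (b := a) hq
    have h2 := Polynomial.coeff_comp_degree_mul_degree (p := P)
      (q := Polynomial.C q * Polynomial.X + Polynomial.C a) (by rw [h1]; exact one_ne_zero)
    rw [h1, mul_one, Polynomial.leadingCoeff_linear hq] at h2
    rw [h2, mul_comm, Polynomial.leadingCoeff]

lemma natDegree_sub_monomial_le {P : ℝ[X]} {k : ℕ} (hP : P.natDegree ≤ k + 1) :
    (P - Polynomial.monomial (k + 1) (P.coeff (k + 1))).natDegree ≤ k := by
  rw [Polynomial.natDegree_le_iff_coeff_eq_zero]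
  intro n hn
  rw [Polynomial.coeff_sub, Polynomial.coeff_monomial]
  split_ifs with h
  · rw [h, sub_self]
  · rw [Polynomial.coeff_eq_zero_of_natDegree_lt (by omega), sub_zero]

lemma half_le_floor {y : ℝ} (hy : 1 ≤ y) : y / 2 ≤ ⌊y⌋₊ := by
  have h1 := Nat.lt_floor_add_one y
  have h2 : (1 : ℝ) ≤ ⌊y⌋₊ := by exact_mod_cast (Nat.one_le_floor_iff y).2 hy
  linarith

/-- One step of the induction on the degree: if the leading coefficients become nearly integral
after multiplication by `q ^ (k + 1)`, they can be discarded on short blocks of step `q`. -/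
lemma HasAPPartition.of_leading_coeff {d k N q m L : ℕ} {ε δ : ℝ} {Q : Fin d → ℝ[X]} (hq : 1 ≤ q)
    (hm : 1 ≤ m) (hε : 0 ≤ ε) (hδ : 0 ≤ δ) (hQ : ∀ i, (Q i).natDegree ≤ k + 1)
    (hqQ : ∀ i, distInt ((q : ℝ) ^ (k + 1) * (Q i).coeff (k + 1)) ≤ δ)
    (h : ∀ P : Fin d → ℝ[X], (∀ i, (P i).natDegree ≤ k) →
      HasAPPartition (fun i n => (P i).eval (n : ℝ)) (range m) L ε) :
    HasAPPartition (fun i n => (Q i).eval (n : ℝ)) (range N) (N / m * L + q * m)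
      (ε + 2 * (m : ℝ) ^ (k + 1) * δ) := by
  refine range_of_blocks hq hm (by positivity) fun a => ?_
  have hq0 : (q : ℝ) ≠ 0 := by positivity
  set R : Fin d → ℝ[X] := fun i =>
    (Q i).comp (Polynomial.C (q : ℝ) * Polynomial.X + Polynomial.C (a : ℝ)) with hR
  have hRd : ∀ i, (R i).natDegree ≤ k + 1 := fun i => natDegree_comp_linear_le (hQ i) _ _
  have hRc : ∀ i, (R i).coeff (k + 1) = (q : ℝ) ^ (k + 1) * (Q i).coeff (k + 1) :=
    fun i => coeff_comp_linear (hQ i) hq0 _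
  refine (h (fun i => R i - Polynomial.monomial (k + 1) ((R i).coeff (k + 1)))
    fun i => natDegree_sub_monomial_le (hRd i)).of_distInt_sub_le fun i n hn n' hn' => ?_
  have hbound : ∀ n ∈ range m, distInt ((n ^ (k + 1) : ℕ) * (R i).coeff (k + 1))
      ≤ (m : ℝ) ^ (k + 1) * δ := by
    intro n hn
    refine (distInt_nat_mul_le _ _).trans (mul_le_mul ?_ ?_ (distInt_nonneg _) (by positivity))
    · exact_mod_cast Nat.pow_le_pow_left (mem_range.1 hn).le (k + 1)
    · rw [hRc]
      exact hqQ i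
  have e : ∀ n : ℕ, (Q i).eval ((a + q * n : ℕ) : ℝ)
      - (R i - Polynomial.monomial (k + 1) ((R i).coeff (k + 1))).eval (n : ℝ)
      = (n ^ (k + 1) : ℕ) * (R i).coeff (k + 1) := by
    intro n
    rw [Polynomial.eval_sub, Polynomial.eval_monomial]
    simp only [hR, Polynomial.eval_comp, Polynomial.eval_add, Polynomial.eval_mul,
      Polynomial.eval_C, Polynomial.eval_X]
    push_cast
    rw [add_comm (a : ℝ)]
    ring
  rw [e, e]
  calc _ ≤ _ := distInt_sub_le _ _
    _ ≤ (m : ℝ) ^ (k + 1) * δ + (m : ℝ) ^ (k + 1) * δ := add_le_add (hbound n hn) (hbound n' hn')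
    _ = _ := by ring

lemma le_two_mul_rpow_one_sub {N : ℕ} (hN : 1 ≤ N) {e : ℝ} (h : (N : ℝ) ^ e ≤ 2) :
    (N : ℝ) ≤ 2 * (N : ℝ) ^ (1 - e) := by
  have hN0 : (0 : ℝ) < N := by exact_mod_cast hN
  calc (N : ℝ) = (N : ℝ) ^ e * (N : ℝ) ^ (1 - e) := by
        rw [← Real.rpow_add hN0]; simp
    _ ≤ _ := mul_le_mul_of_nonneg_right h (by positivity)

lemma exists_hasAPPartition_range (k : ℕ) : ∃ c₁ c₂ C : ℝ, 0 < c₁ ∧ c₁ ≤ 1 ∧ 0 < c₂ ∧ 0 < C ∧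
    ∀ N d : ℕ, 1 ≤ N → 1 ≤ d → ∀ Q : Fin d → ℝ[X], (∀ i, (Q i).natDegree ≤ k) →
      ∃ L : ℕ, (L : ℝ) ≤ 2 * (N : ℝ) ^ (1 - c₁ / (d : ℝ) ^ c₂) ∧
        HasAPPartition (fun i n => (Q i).eval (n : ℝ)) (range N) L
          (C * (N : ℝ) ^ (-(c₁ / (d : ℝ) ^ c₂))) := by
  induction k with
  | zero =>
    refine ⟨1, 1, 1, one_pos, le_rfl, one_pos, one_pos, fun N d hN hd Q hQ => ⟨1, ?_, ?_⟩⟩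
    · have h1 : (1 : ℝ) ≤ (N : ℝ) ^ (1 - 1 / (d : ℝ) ^ (1 : ℝ)) := by
        refine Real.one_le_rpow (by exact_mod_cast hN) ?_
        rw [Real.rpow_one, sub_nonneg]
        exact div_le_one_of_le₀ (by exact_mod_cast hd) (by positivity)
      push_cast
      linarith
    · refine ⟨{range N}, ?_, by simp, by simp, by simp, ?_⟩
      · simp only [mem_singleton, forall_eq]
        exact ⟨0, 1, N, le_rfl, by simp⟩
      · intro P hP i n hn n' hn'
        dsimp only
        rw [Polynomial.eq_C_of_natDegree_le_zero (hQ i)]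
        simp only [Polynomial.eval_C, sub_self]
        rw [show distInt 0 = 0 by simp [distInt]]
        positivity
  | succ k ih =>
    obtain ⟨c₁, c₂, C, hc₁, hc₁', hc₂, hC, h⟩ := ih
    obtain ⟨c, hc, hc', hrec⟩ := exists_distInt_pow_mul_le_rpow k
    refine ⟨c * c₁ / (12 * (k + 1)), 3 + c₂, 2 * C + 16, by positivity, ?_, by positivity,
      by positivity, fun N d hN hd Q hQ => ?_⟩
    · rw [div_le_one (by positivity)]
      have h1 : c * c₁ ≤ 1 := mul_le_one₀ hc' hc₁.le hc₁'
      have h2 : (0 : ℝ) ≤ k := by positivity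
      linarith
    have hd0 : (0 : ℝ) < d := by exact_mod_cast hd
    have hd1 : (1 : ℝ) ≤ d := by exact_mod_cast hd
    have hN0 : (0 : ℝ) < N := by exact_mod_cast hN
    have hN1 : (1 : ℝ) ≤ N := by exact_mod_cast hN
    set δ : ℝ := c / (d : ℝ) ^ 3 with hδ
    set e₁ : ℝ := c₁ / (d : ℝ) ^ c₂ with he₁
    set γ : ℝ := δ / (4 * (k + 1)) with hγ
    have he : c * c₁ / (12 * (k + 1)) / (d : ℝ) ^ (3 + c₂) = γ * e₁ / 3 := by
      have h3 : (d : ℝ) ^ (3 + c₂) = (d : ℝ) ^ 3 * (d : ℝ) ^ c₂ := by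
        rw [Real.rpow_add hd0]
        norm_cast
      rw [h3, hγ, hδ, he₁]
      field_simp
      norm_num
    rw [he]
    have hδ0 : 0 < δ := by positivity
    have hδ1 : δ ≤ 1 := by
      refine div_le_one_of_le₀ (hc'.trans (one_le_pow₀ hd1)) (by positivity)
    have he0 : 0 < e₁ := by positivity
    have he1 : e₁ ≤ 1 := by
      refine div_le_one_of_le₀ (hc₁'.trans (Real.one_le_rpow hd1 hc₂.le)) (by positivity)
    have hγ0 : 0 < γ := by positivity
    have hγk : γ * (k + 1) = δ / 4 := by
      rw [hγ]
      field_simp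
    have hγδ : γ ≤ δ / 4 := by
      have : (0 : ℝ) ≤ k := by positivity
      nlinarith
    have heγ : γ * e₁ ≤ γ := mul_le_of_le_one_right hγ0.le he1
    have heγ0 : 0 < γ * e₁ := by positivity
    rcases le_total ((N : ℝ) ^ (γ * e₁ / 3)) 2 with hsmall | hlarge
    · refine ⟨N, le_two_mul_rpow_one_sub hN hsmall, ?_⟩
      have := HasAPPartition.singletons (fun (i : Fin d) n => (Q i).eval (n : ℝ)) (range N)
        (ε := (2 * C + 16) * (N : ℝ) ^ (-(γ * e₁ / 3))) (by positivity)
      rwa [card_range] at this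
    set r := Nat.sqrt N with hr
    have hr1 : 1 ≤ r := Nat.sqrt_pos.2 hN
    have hr0 : (0 : ℝ) < r := by exact_mod_cast hr1
    obtain ⟨q, hq1, hqr, hqQ⟩ := hrec d r hd hr1 fun i => (Q i).coeff (k + 1)
    have hrN : (r : ℝ) ≤ (N : ℝ) ^ (1 / 2 : ℝ) := by
      rw [← Real.sqrt_eq_rpow]
      exact Real.nat_sqrt_le_real_sqrt
    have hrN' : (N : ℝ) ^ (1 / 2 : ℝ) ≤ 2 * r := by
      rw [← Real.sqrt_eq_rpow]
      have h1 := Real.real_sqrt_le_nat_sqrt_succ (a := N)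
      have h2 : (1 : ℝ) ≤ r := by exact_mod_cast hr1
      linarith
    have hqQ' : ∀ i, distInt ((q : ℝ) ^ (k + 1) * (Q i).coeff (k + 1))
        ≤ 8 * (N : ℝ) ^ (-(δ / 2)) := by
      refine fun i => (hqQ i).trans ?_
      have h1 : (N : ℝ) ^ (δ / 2) ≤ 2 * (r : ℝ) ^ δ := by
        calc (N : ℝ) ^ (δ / 2) = ((N : ℝ) ^ (1 / 2 : ℝ)) ^ δ := by
              rw [← Real.rpow_mul hN0.le]
              ring_nf
          _ ≤ (2 * r) ^ δ := Real.rpow_le_rpow (by positivity) hrN' hδ0.le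
          _ = 2 ^ δ * (r : ℝ) ^ δ := Real.mul_rpow (by norm_num) hr0.le
          _ ≤ 2 ^ (1 : ℝ) * (r : ℝ) ^ δ := by
            gcongr
            norm_num
          _ = _ := by rw [Real.rpow_one]
      rw [Real.rpow_neg hr0.le, Real.rpow_neg hN0.le, ← div_eq_mul_inv, ← div_eq_mul_inv,
        div_le_div_iff₀ (by positivity) (by positivity)]
      linarith
    set m := ⌊(N : ℝ) ^ γ⌋₊ with hm
    have hNγ : 1 ≤ (N : ℝ) ^ γ := Real.one_le_rpow hN1 hγ0.le
    have hm1 : 1 ≤ m := (Nat.one_le_floor_iff _).2 hNγ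
    have hm0 : (0 : ℝ) < m := by exact_mod_cast hm1
    have hmN : (m : ℝ) ≤ (N : ℝ) ^ γ := Nat.floor_le (by positivity)
    have hmN' : (m : ℝ) ^ (-e₁) ≤ 2 * (N : ℝ) ^ (-(γ * e₁)) := by
      have h1 : (N : ℝ) ^ (γ * e₁) ≤ 2 * (m : ℝ) ^ e₁ := by
        calc (N : ℝ) ^ (γ * e₁) = ((N : ℝ) ^ γ) ^ e₁ := Real.rpow_mul hN0.le _ _
          _ ≤ (2 * m) ^ e₁ :=
            Real.rpow_le_rpow (by positivity) (by linarith [half_le_floor hNγ]) he0.le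
          _ = 2 ^ e₁ * (m : ℝ) ^ e₁ := Real.mul_rpow (by norm_num) hm0.le
          _ ≤ 2 ^ (1 : ℝ) * (m : ℝ) ^ e₁ := by
            gcongr
            norm_num
          _ = _ := by rw [Real.rpow_one]
      rw [Real.rpow_neg hm0.le, Real.rpow_neg hN0.le, ← div_eq_mul_inv, inv_eq_one_div,
        div_le_div_iff₀ (by positivity) (by positivity)]
      linarith
    set L := ⌊2 * (m : ℝ) ^ (1 - e₁)⌋₊ with hL
    have hL' : (L : ℝ) ≤ 2 * (m : ℝ) ^ (1 - e₁) := Nat.floor_le (by positivity)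
    have hpart := HasAPPartition.of_leading_coeff (N := N) (m := m) (L := L)
      (ε := C * (m : ℝ) ^ (-e₁)) hq1 hm1 (by positivity) (by positivity) hQ hqQ' fun P hP => by
        obtain ⟨L', hL'', h'⟩ := h m d hm1 hd P hP
        exact h'.mono (Nat.le_floor hL'') le_rfl
    refine ⟨_, ?_, hpart.mono le_rfl ?_⟩
    · have h1 : ((N / m : ℕ) : ℝ) * L ≤ 4 * (N : ℝ) ^ (1 - γ * e₁) := by
        calc ((N / m : ℕ) : ℝ) * L ≤ (N / m) * (2 * (m : ℝ) ^ (1 - e₁)) :=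
              mul_le_mul Nat.cast_div_le hL' (by positivity) (by positivity)
          _ = 2 * N * (m : ℝ) ^ (-e₁) := by
            rw [sub_eq_add_neg, Real.rpow_add hm0, Real.rpow_one]
            field_simp
          _ ≤ 2 * N * (2 * (N : ℝ) ^ (-(γ * e₁))) := by gcongr
          _ = _ := by
            rw [sub_eq_add_neg, Real.rpow_add hN0, Real.rpow_one]
            ring
      have h2 : (q : ℝ) * m ≤ (N : ℝ) ^ (1 - γ * e₁) := by
        calc (q : ℝ) * m ≤ (N : ℝ) ^ (1 / 2 : ℝ) * (N : ℝ) ^ γ := by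
              refine mul_le_mul ?_ hmN hm0.le (by positivity)
              exact le_trans (by exact_mod_cast hqr) hrN
          _ = (N : ℝ) ^ (1 / 2 + γ) := (Real.rpow_add hN0 _ _).symm
          _ ≤ _ := Real.rpow_le_rpow_of_exponent_le hN1 (by linarith)
      have h3 : (N : ℝ) ^ (1 - γ * e₁ / 3)
          = (N : ℝ) ^ (1 - γ * e₁) * ((N : ℝ) ^ (γ * e₁ / 3) * (N : ℝ) ^ (γ * e₁ / 3)) := by
        rw [← Real.rpow_add hN0, ← Real.rpow_add hN0]
        ring_nf
      have h4 : (2 : ℝ) * 2 ≤ (N : ℝ) ^ (γ * e₁ / 3) * (N : ℝ) ^ (γ * e₁ / 3) :=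
        mul_le_mul hlarge hlarge (by norm_num) (by positivity)
      have h5 : 0 < (N : ℝ) ^ (1 - γ * e₁) := by positivity
      rw [h3]
      push_cast
      nlinarith [mul_le_mul_of_nonneg_left h4 h5.le]
    · have h1 : (N : ℝ) ^ (-(γ * e₁)) ≤ (N : ℝ) ^ (-(γ * e₁ / 3)) :=
        Real.rpow_le_rpow_of_exponent_le hN1 (by linarith)
      have h2 : (m : ℝ) ^ (k + 1) * (N : ℝ) ^ (-(δ / 2)) ≤ (N : ℝ) ^ (-(γ * e₁ / 3)) := by
        calc (m : ℝ) ^ (k + 1) * (N : ℝ) ^ (-(δ / 2))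
            ≤ ((N : ℝ) ^ γ) ^ (k + 1) * (N : ℝ) ^ (-(δ / 2)) := by gcongr
          _ = (N : ℝ) ^ (γ * (k + 1) + -(δ / 2)) := by
            rw [Real.rpow_add hN0, Real.rpow_mul hN0.le, ← Real.rpow_natCast]
            push_cast
            rfl
          _ ≤ _ := Real.rpow_le_rpow_of_exponent_le hN1 (by linarith)
      calc C * (m : ℝ) ^ (-e₁) + 2 * (m : ℝ) ^ (k + 1) * (8 * (N : ℝ) ^ (-(δ / 2)))
          = C * (m : ℝ) ^ (-e₁) + 16 * ((m : ℝ) ^ (k + 1) * (N : ℝ) ^ (-(δ / 2))) := by ring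
        _ ≤ C * (2 * (N : ℝ) ^ (-(γ * e₁ / 3))) + 16 * (N : ℝ) ^ (-(γ * e₁ / 3)) := by
          gcongr
          linarith
        _ = _ := by ring

end

/-- **Schmidt-type decomposition for polynomials (Lemma 2.2).**
Fix `k ≥ 0`. There are constants `c₁, c₂, C > 0` (depending only on `k`) such that for all
`N, d ≥ 1` and all real polynomials `Q₁,…,Q_d` of degree at most `k`, one can partition
`[N] = {1,…,N}` into `L` disjoint arithmetic progressions `P₁,…,P_L` with
`N/L ≥ N^{c₁/d^{c₂}}/2` and such that for every `i, j` and all `n, n' ∈ P_j`,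
`‖Q_i(n) − Q_i(n')‖_{ℝ/ℤ} ≤ C · N^{−c₁/d^{c₂}}`. -/
theorem schmidt_decomposition_polynomials (k : ℕ) :
    ∃ c₁ c₂ C : ℝ, 0 < c₁ ∧ 0 < c₂ ∧ 0 < C ∧
      ∀ N d : ℕ, 1 ≤ N → 1 ≤ d →
        ∀ Q : Fin d → Polynomial ℝ, (∀ i, (Q i).natDegree ≤ k) →
          ∃ (L : ℕ) (P : Fin L → Finset ℕ),
            (∀ j, ∃ a q m : ℕ, 1 ≤ q ∧
              P j = (Finset.range m).image (fun t => a + t * q)) ∧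
            (∀ j j' : Fin L, j ≠ j' → Disjoint (P j) (P j')) ∧
            (Finset.univ.biUnion P = Finset.Icc 1 N) ∧
            ((N : ℝ) ^ (c₁ / (d : ℝ) ^ c₂) / 2 ≤ (N : ℝ) / (L : ℝ)) ∧
            (∀ i : Fin d, ∀ j : Fin L, ∀ n ∈ P j, ∀ n' ∈ P j,
              |((Q i).eval (n : ℝ) - (Q i).eval (n' : ℝ)) -
                  round ((Q i).eval (n : ℝ) - (Q i).eval (n' : ℝ))|
                ≤ C * (N : ℝ) ^ (-(c₁ / (d : ℝ) ^ c₂))) := by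
  obtain ⟨c₁, c₂, C, hc₁, -, hc₂, hC, h⟩ := exists_hasAPPartition_range k
  refine ⟨c₁, c₂, C, hc₁, hc₂, hC, fun N d hN hd Q hQ => ?_⟩
  obtain ⟨L, hL, hpart⟩ := h N d hN hd
    (fun i => (Q i).comp (Polynomial.C 1 * Polynomial.X + Polynomial.C 1))
    (fun i => natDegree_comp_linear_le (hQ i) 1 1)
  obtain ⟨F, h1, h2, h3, h4, h5⟩ : HasAPPartition (fun i n => (Q i).eval (n : ℝ))
      (Finset.Icc 1 N) L (C * (N : ℝ) ^ (-(c₁ / (d : ℝ) ^ c₂))) := by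
    have e : Finset.Icc 1 N = (Finset.range N).image fun n => 1 + 1 * n := by
      ext n
      simp only [Finset.mem_Icc, Finset.mem_image, Finset.mem_range]
      exact ⟨fun hn => ⟨n - 1, by omega, by omega⟩, by rintro ⟨x, hx, rfl⟩; omega⟩
    rw [e]
    refine HasAPPartition.image le_rfl ?_
    convert hpart using 3 with i n
    rw [Polynomial.eval_comp]
    congr 1
    simp [add_comm]
  have hN0 : (0 : ℝ) < N := by exact_mod_cast hN
  refine ⟨F.card, fun j => (F.equivFin.symm j : Finset ℕ), fun j => h1 _ (Subtype.coe_prop _),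
    fun j j' hj => h2 _ (Subtype.coe_prop _) _ (Subtype.coe_prop _) fun e => hj ?_, ?_, ?_,
    fun i j => h5 _ (Subtype.coe_prop _) i⟩
  · exact F.equivFin.symm.injective (Subtype.ext e)
  · rw [← h3]
    ext n
    simp only [Finset.mem_biUnion, Finset.mem_univ, true_and, id]
    constructor
    · rintro ⟨j, hj⟩
      exact ⟨_, Subtype.coe_prop _, hj⟩
    · rintro ⟨P, hP, hn⟩
      exact ⟨F.equivFin ⟨P, hP⟩, by simpa using hn⟩
  · have hF : 0 < F.card := by
      rw [Finset.card_pos, Finset.nonempty_iff_ne_empty]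
      rintro rfl
      have : (1 : ℕ) ∈ Finset.Icc 1 N := Finset.mem_Icc.2 ⟨le_rfl, hN⟩
      simp [← h3] at this
    have hFL : (F.card : ℝ) ≤ 2 * (N : ℝ) ^ (1 - c₁ / (d : ℝ) ^ c₂) :=
      le_trans (by exact_mod_cast h4) hL
    rw [div_le_div_iff₀ two_pos (by exact_mod_cast hF)]
    calc (N : ℝ) ^ (c₁ / (d : ℝ) ^ c₂) * F.card
        ≤ (N : ℝ) ^ (c₁ / (d : ℝ) ^ c₂) * (2 * (N : ℝ) ^ (1 - c₁ / (d : ℝ) ^ c₂)) := by gcongr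
      _ = 2 * (N : ℝ) ^ (c₁ / (d : ℝ) ^ c₂ + (1 - c₁ / (d : ℝ) ^ c₂)) := by
        rw [Real.rpow_add hN0]
        ring
      _ = N * 2 := by
        rw [add_sub_cancel, Real.rpow_one, mul_comm]
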